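/- arXiv:2601.13332 — 4 statements merged into one kernel-verified Lean document; each statement's English description precedes it below -/
import Mathlib

section
/- Let ℓ > 0 and μ ∈ ℝ, set τ := 2πi/ℓ, assume θ₃(μ;τ) ≠ 0, and set z_μ := (1/2 − μ)·ℓ + πi. Then for every n ≥ 3 and all points z₁,…,zₙ ∈ ℂ with z_j − z_k ∉ Λ_ℓ for all j ≠ k, one has ∑_{σ∈Cₙ} ∏_{k=1}^n f_μ(z_{σ(k)} − z_k) = (−2i/π)ⁿ·℘^{(n−2)}(z_μ;Λ_ℓ). In particular, this cycle sum does not depend on z₁,…,zₙ. -/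
open Complex

noncomputable section

/-- Jacobi theta function `θ₁(w;τ)` with nome `q = exp(iπτ)`. -/
def theta1 (τ w : ℂ) : ℂ :=
  -Complex.I * ∑' n : ℤ, (-1 : ℂ) ^ n *
    Complex.exp (Real.pi * Complex.I * τ * ((n : ℂ) + 1 / 2) ^ 2) *
    Complex.exp ((2 * (n : ℂ) + 1) * Real.pi * Complex.I * w)

/-- Jacobi theta function `θ₃(w;τ)` with nome `q = exp(iπτ)`. -/
def theta3 (τ w : ℂ) : ℂ :=
  ∑' n : ℤ, Complex.exp (Real.pi * Complex.I * τ * (n : ℂ) ^ 2) *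
    Complex.exp (2 * Real.pi * Complex.I * (n : ℂ) * w)

/-- The modulus `τ = 2πi/ℓ`. -/
def tau (ℓ : ℝ) : ℂ := 2 * Real.pi * Complex.I / (ℓ : ℂ)

/-- The function `g_μ(w) = (2/(πi))·θ₁′(0;τ)·θ₃(w+μ;τ)/(θ₃(μ;τ)·θ₁(w;τ))` with `τ = 2πi/ℓ`. -/
def gmu (ℓ μ : ℝ) (w : ℂ) : ℂ :=
  2 / (Real.pi * Complex.I) * deriv (theta1 (tau ℓ)) 0 * theta3 (tau ℓ) (w + (μ : ℂ)) /
    (theta3 (tau ℓ) (μ : ℂ) * theta1 (tau ℓ) w)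

/-- The function `f_μ(z) = ℓ⁻¹ g_μ(z/ℓ)`. -/
def fmu (ℓ μ : ℝ) (z : ℂ) : ℂ := (ℓ : ℂ)⁻¹ * gmu ℓ μ (z / (ℓ : ℂ))

/-- The lattice `{m ω₁ + n ω₂ : m, n ∈ ℤ}`. -/
def lat (ω₁ ω₂ : ℂ) : Set ℂ := {z : ℂ | ∃ m n : ℤ, z = (m : ℂ) * ω₁ + (n : ℂ) * ω₂}

/-- The Weierstrass `℘`-function for the lattice spanned by `ω₁, ω₂`:
`℘(z) = z⁻² + ∑_{ω ∈ Λ∖{0}} ((z−ω)⁻² − ω⁻²)`. -/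
def wp (ω₁ ω₂ : ℂ) (z : ℂ) : ℂ :=
  1 / z ^ 2 + ∑' p : {p : ℤ × ℤ // p ≠ 0},
    (1 / (z - ((p.1.1 : ℂ) * ω₁ + (p.1.2 : ℂ) * ω₂)) ^ 2
      - 1 / ((p.1.1 : ℂ) * ω₁ + (p.1.2 : ℂ) * ω₂) ^ 2)

/-- The point `z_μ = (1/2 − μ)ℓ + πi`. -/
def zmu (ℓ μ : ℝ) : ℂ := (1 / 2 - (μ : ℂ)) * (ℓ : ℂ) + Real.pi * Complex.I

open scoped Classical in
/-- The cycle sum `∑_{σ ∈ Cₙ} ∏_{k=1}^n f(z_{σ(k)} − z_k)`, where `Cₙ` is the set of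
permutations of `{1,…,n}` consisting of a single `n`-cycle. -/
def cycleSum (n : ℕ) (f : ℂ → ℂ) (z : Fin n → ℂ) : ℂ :=
  ∑ σ ∈ Finset.univ.filter
      (fun σ : Equiv.Perm (Fin n) => σ.IsCycle ∧ σ.support = Finset.univ),
    ∏ k : Fin n, f (z (σ k) - z k)

/-- The open horizontal strip `S = {0 < Im z < π}`. -/
def strip : Set ℂ := {z : ℂ | 0 < z.im ∧ z.im < Real.pi}

/-- The top substrip `S_ε = {π − ε < Im z < π}`. -/
def topStrip (ε : ℝ) : Set ℂ := {z : ℂ | Real.pi - ε < z.im ∧ z.im < Real.pi}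

end


section Combinatorics

open Equiv Equiv.Perm

/-- A permutation all of whose points lie in one orbit. -/
def FullCyc {α : Type*} (σ : Equiv.Perm α) : Prop := ∀ x y, σ.SameCycle x y

lemma fullCyc_iff {n : ℕ} (hn : 2 ≤ n) (σ : Equiv.Perm (Fin n)) :
    (σ.IsCycle ∧ σ.support = Finset.univ) ↔ FullCyc σ := by
  constructor
  · rintro ⟨h, hs⟩ x y
    have hx : ∀ x, σ x ≠ x := fun x => by
      have : x ∈ σ.support := by rw [hs]; exact Finset.mem_univ x
      exact Equiv.Perm.mem_support.1 this
    exact h.sameCycle (hx x) (hx y)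
  · intro h
    have hx : ∀ x, σ x ≠ x := fun x hx => by
      have : Nontrivial (Fin n) := Fin.nontrivial_iff_two_le.2 hn
      obtain ⟨y, hy⟩ := exists_ne x
      exact hy ((h x y).eq_of_left hx).symm
    refine ⟨⟨⟨0, by omega⟩, hx _, fun y _ => h _ y⟩, ?_⟩
    ext x
    simp [hx x]

lemma fullCyc_decomp_zero {n : ℕ} (hn : 1 ≤ n) (τ : Equiv.Perm (Fin n)) :
    ¬ FullCyc (decomposeFin.symm ((0 : Fin (n + 1)), τ)) := by
  intro h
  have h1 := (h 0 (Fin.succ ⟨0, by omega⟩)).eq_of_left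
    (show _ = _ from decomposeFin_symm_apply_zero 0 τ)
  exact (Fin.succ_ne_zero _) h1.symm

lemma sameCycle_map {α β : Type*} (σ : Equiv.Perm α) (τ : Equiv.Perm β) (p : α → β)
    (h : ∀ x, τ.SameCycle (p x) (p (σ x))) {x y : α} (hxy : σ.SameCycle x y) :
    τ.SameCycle (p x) (p y) := by
  have key : ∀ (k : ℕ) x, τ.SameCycle (p x) (p ((σ ^ k) x)) := by
    intro k
    induction k with
    | zero => intro x; exact SameCycle.refl _ _
    | succ k ih =>
      intro x
      rw [pow_succ']
      exact (ih x).trans (h _)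
  obtain ⟨i, hi⟩ := hxy
  obtain ⟨k, rfl | rfl⟩ := Int.eq_nat_or_neg i
  · rw [zpow_natCast] at hi
    rw [← hi]; exact key k x
  · have : x = (σ ^ k) y := by
      rw [← hi, zpow_neg, zpow_natCast]; simp
    rw [this]; exact (key k y).symm

lemma fullCyc_decomp_succ {n : ℕ} (i : Fin n) (τ : Equiv.Perm (Fin n)) :
    FullCyc (decomposeFin.symm (i.succ, τ)) ↔ FullCyc τ := by
  set σ := decomposeFin.symm (i.succ, τ) with hσ
  have h0 : σ 0 = i.succ := decomposeFin_symm_apply_zero _ _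
  have h1 : ∀ y, τ y = i → σ y.succ = 0 := fun y hy => by
    rw [hσ, decomposeFin_symm_apply_succ, hy, swap_apply_right]
  have h2 : ∀ y, τ y ≠ i → σ y.succ = (τ y).succ := fun y hy => by
    rw [hσ, decomposeFin_symm_apply_succ, swap_apply_of_ne_of_ne (Fin.succ_ne_zero _)]
    simpa using hy
  constructor
  · intro h x y
    have := sameCycle_map σ τ (fun x => Fin.cases i id x) ?_ (h x.succ y.succ)
    · simpa using this
    · intro x
      refine Fin.cases ?_ (fun y => ?_) x
      · rw [h0]; exact SameCycle.refl _ _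
      · by_cases hy : τ y = i
        · rw [h1 y hy, ← hy]; simp [SameCycle.refl]
        · rw [h2 y hy]; simp [SameCycle.refl]
  · intro h
    have hs : ∀ x y : Fin n, σ.SameCycle x.succ y.succ := fun x y => by
      refine sameCycle_map τ σ Fin.succ ?_ (h x y)
      intro y
      by_cases hy : τ y = i
      · rw [hy, ← h0, sameCycle_apply_right, ← h1 y hy, sameCycle_apply_right]
      · rw [← h2 y hy, sameCycle_apply_right]
    have hz : ∀ y : Fin n, σ.SameCycle 0 y.succ := fun y => by
      rw [← sameCycle_apply_left, h0]; exact hs _ _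
    intro x y
    refine Fin.cases ?_ (fun x => ?_) x <;> refine Fin.cases ?_ (fun y => ?_) y
    · exact SameCycle.refl _ _
    · exact hz y
    · exact (hz x).symm
    · exact hs x y

open scoped Classical in
lemma cycleSum_eq {n : ℕ} (hn : 2 ≤ n) (f : ℂ → ℂ) (z : Fin n → ℂ) :
    cycleSum n f z = ∑ σ ∈ Finset.univ.filter (fun σ : Equiv.Perm (Fin n) => FullCyc σ),
      ∏ k : Fin n, f (z (σ k) - z k) := by
  unfold cycleSum
  congr 1
  ext σ
  simp only [Finset.mem_filter, Finset.mem_univ, true_and]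
  convert fullCyc_iff hn σ

lemma prod_insert (n : ℕ) (f : ℂ → ℂ) (z : Fin (n + 1) → ℂ) (τ : Equiv.Perm (Fin n)) (j : Fin n) :
    ∏ k, f (z (decomposeFin.symm ((τ j).succ, τ) k) - z k) =
      f (z (τ j).succ - z 0) * f (z 0 - z j.succ) *
        ∏ k ∈ Finset.univ.erase j, f (z (τ k).succ - z k.succ) := by
  rw [Fin.prod_univ_succ, decomposeFin_symm_apply_zero, mul_assoc]
  congr 1
  rw [← Finset.mul_prod_erase Finset.univ _ (Finset.mem_univ j)]
  congr 1
  · rw [decomposeFin_symm_apply_succ, swap_apply_right]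
  · refine Finset.prod_congr rfl fun k hk => ?_
    rw [decomposeFin_symm_apply_succ, swap_apply_of_ne_of_ne (Fin.succ_ne_zero _)]
    have := Finset.ne_of_mem_erase hk
    simpa using this

open scoped Classical in
lemma cycleSum_succ {n : ℕ} (hn : 2 ≤ n) (f : ℂ → ℂ) (z : Fin (n + 1) → ℂ) :
    cycleSum (n + 1) f z =
      ∑ τ ∈ Finset.univ.filter (fun σ : Equiv.Perm (Fin n) => FullCyc σ), ∑ j : Fin n,
        f (z (τ j).succ - z 0) * f (z 0 - z j.succ) *
        ∏ k ∈ Finset.univ.erase j, f (z (τ k).succ - z k.succ) := by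
  rw [cycleSum_eq (by omega), Finset.sum_filter, ← decomposeFin.symm.sum_comp,
    Fintype.sum_prod_type_right, Finset.sum_filter]
  refine Finset.sum_congr rfl fun τ _ => ?_
  rw [Fin.sum_univ_succ, if_neg (fullCyc_decomp_zero (by omega) τ), zero_add]
  simp only [fullCyc_decomp_succ]
  split_ifs with h
  · rw [← Equiv.sum_comp τ]
    exact Finset.sum_congr rfl fun j _ => prod_insert n f z τ j
  · simp

/-- The key recursion. -/
lemma cycleSum_rec {n : ℕ} (hn : 2 ≤ n) (f h D : ℂ → ℂ) (z : Fin (n + 1) → ℂ)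
    (hodd : ∀ x, h (-x) = - h x)
    (hfay : ∀ i j : Fin n, i ≠ j → f (z i.succ - z 0) * f (z 0 - z j.succ) =
      f (z i.succ - z j.succ) * (h (z i.succ - z 0) + h (z 0 - z j.succ)) -
        D (z i.succ - z j.succ)) :
    cycleSum (n + 1) f z = - 
      ∑ τ ∈ @Finset.filter _ (fun σ : Equiv.Perm (Fin n) => FullCyc σ) (Classical.decPred _)
        Finset.univ, ∑ j : Fin n,
        D (z (τ j).succ - z j.succ) *
        ∏ k ∈ Finset.univ.erase j, f (z (τ k).succ - z k.succ) := by
  classical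
  rw [cycleSum_succ hn, ← Finset.sum_neg_distrib]
  refine Finset.sum_congr (by congr!) fun τ hτ => ?_
  have hτ : FullCyc τ := by simpa using hτ
  have hne : ∀ j, τ j ≠ j := fun j hj => by
    have := ((fullCyc_iff hn τ).2 hτ).2
    have h2 : j ∈ τ.support := by rw [this]; exact Finset.mem_univ j
    exact Equiv.Perm.mem_support.1 h2 hj
  have e : ∀ j, f (z (τ j).succ - z 0) * f (z 0 - z j.succ) *
        ∏ k ∈ Finset.univ.erase j, f (z (τ k).succ - z k.succ) =
      (∏ k, f (z (τ k).succ - z k.succ)) * (h (z (τ j).succ - z 0) - h (z j.succ - z 0)) -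
        D (z (τ j).succ - z j.succ) *
        ∏ k ∈ Finset.univ.erase j, f (z (τ k).succ - z k.succ) := fun j => by
    rw [hfay _ _ (hne j), ← Finset.mul_prod_erase Finset.univ _ (Finset.mem_univ j)]
    have : h (z 0 - z j.succ) = - h (z j.succ - z 0) := by rw [← hodd]; ring_nf
    rw [this]; ring
  rw [Finset.sum_congr rfl fun j _ => e j, Finset.sum_sub_distrib, ← Finset.mul_sum,
    Finset.sum_sub_distrib, Equiv.sum_comp τ (fun j => h (z j.succ - z 0))]
  simp

lemma cycleSum_two (f : ℂ → ℂ) (z : Fin 2 → ℂ) :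
    cycleSum 2 f z = f (z 1 - z 0) * f (z 0 - z 1) := by
  classical
  rw [cycleSum_eq le_rfl]
  have : (Finset.univ.filter (fun σ : Equiv.Perm (Fin 2) => FullCyc σ)) = {swap 0 1} := by
    ext σ
    simp only [Finset.mem_filter, Finset.mem_univ, true_and, Finset.mem_singleton]
    constructor
    · intro h
      have hne : ∀ j, σ j ≠ j := fun j hj => by
        have := ((fullCyc_iff le_rfl σ).2 h).2
        have h2 : j ∈ σ.support := by rw [this]; exact Finset.mem_univ j
        exact Equiv.Perm.mem_support.1 h2 hj
      ext j
      have h0 := hne 0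
      have h1 := hne 1
      fin_cases j
      · simp; omega
      · simp; omega
    · rintro rfl x y
      have : SameCycle (swap (0 : Fin 2) 1) 0 1 := ⟨1, by simp⟩
      fin_cases x <;> fin_cases y
      · exact SameCycle.refl _ _
      · exact this
      · exact this.symm
      · exact SameCycle.refl _ _
  rw [this]
  simp [Fin.prod_univ_two]

lemma cycleSum_congr {n : ℕ} (hn : 2 ≤ n) (f g : ℂ → ℂ) (z : Fin n → ℂ) (c k : ℂ)
    (h : ∀ i j, i ≠ j → f (z i - z j) = c * Complex.exp (k * (z i - z j)) * g (z i - z j)) :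
    cycleSum n f z = c ^ n * cycleSum n g z := by
  classical
  rw [cycleSum_eq hn, cycleSum_eq hn, Finset.mul_sum]
  refine Finset.sum_congr rfl fun τ hτ => ?_
  have hτ : FullCyc τ := by simpa using hτ
  have hne : ∀ j, τ j ≠ j := fun j hj => by
    have := ((fullCyc_iff hn τ).2 hτ).2
    have h2 : j ∈ τ.support := by rw [this]; exact Finset.mem_univ j
    exact Equiv.Perm.mem_support.1 h2 hj
  rw [Finset.prod_congr rfl fun j _ => h _ _ (hne j), Finset.prod_mul_distrib,
    Finset.prod_mul_distrib, ← Complex.exp_sum, ← Finset.mul_sum, Finset.sum_sub_distrib,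
    Equiv.sum_comp τ z]
  simp

end Combinatorics

section Analysis

open Filter Topology

lemma differentiable_dslope' {u : ℂ → ℂ} (hu : Differentiable ℂ u) (p : ℂ) :
    Differentiable ℂ (dslope u p) := by
  rw [← differentiableOn_univ, Complex.differentiableOn_dslope Filter.univ_mem]
  exact hu.differentiableOn

lemma eq_sub_mul_dslope {u : ℂ → ℂ} {p : ℂ} (hp : u p = 0) (x : ℂ) :
    u x = (x - p) * dslope u p x := by
  have := sub_smul_dslope u p x
  rw [smul_eq_mul, hp, sub_zero] at this
  exact this.symm

/-- Division of entire functions when the denominator only has simple zeros. -/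
lemma exists_entire_quotient {u v : ℂ → ℂ} (hu : Differentiable ℂ u) (hv : Differentiable ℂ v)
    (h : ∀ x, v x = 0 → u x = 0 ∧ deriv v x ≠ 0) :
    ∃ g : ℂ → ℂ, Differentiable ℂ g ∧ ∀ x, u x = g x * v x := by
  classical
  refine ⟨fun x => if v x = 0 then deriv u x / deriv v x else u x / v x, ?_, ?_⟩
  · intro p
    by_cases hp : v p = 0
    · obtain ⟨hup, hvp⟩ := h p hp
      have hs : dslope v p p ≠ 0 := by rwa [dslope_same]
      have hev : ∀ᶠ x in 𝓝 p, dslope v p x ≠ 0 :=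
        (differentiable_dslope' hv p).continuous.continuousAt.eventually_ne hs
      have hd : DifferentiableAt ℂ (fun x => dslope u p x / dslope v p x) p :=
        ((differentiable_dslope' hu p) p).div ((differentiable_dslope' hv p) p) hs
      refine hd.congr_of_eventuallyEq ?_
      filter_upwards [hev] with x hx
      by_cases hxp : x = p
      · subst hxp
        simp [hp]
      · have hx0 : x - p ≠ 0 := sub_ne_zero.2 hxp
        have e1 := eq_sub_mul_dslope hup x
        have e2 := eq_sub_mul_dslope hp x
        have : v x ≠ 0 := by rw [e2]; exact mul_ne_zero hx0 hx
        rw [if_neg this, e1, e2, mul_div_mul_left _ _ hx0]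
    · have hev : ∀ᶠ x in 𝓝 p, v x ≠ 0 := hv.continuous.continuousAt.eventually_ne hp
      refine ((hu p).div (hv p) hp).congr_of_eventuallyEq ?_
      filter_upwards [hev] with x hx
      simp [hx]
  · intro x
    by_cases hx : v x = 0
    · simp [hx, (h x hx).1]
    · simp [hx]

/-- Liouville for doubly periodic entire functions. -/
lemma periodic_const {ℓ : ℝ} (hℓ : 0 < ℓ) {g : ℂ → ℂ} (hg : Differentiable ℂ g)
    (h1 : ∀ x, g (x + ℓ) = g x) (h2 : ∀ x, g (x + 2 * Real.pi * Complex.I) = g x) (x y : ℂ) :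
    g x = g y := by
  refine hg.apply_eq_apply_of_bounded ?_ x y
  have hK : IsCompact ((Set.Icc (0 : ℝ) ℓ) ×ℂ (Set.Icc (0 : ℝ) (2 * Real.pi))) :=
    isCompact_Icc.reProdIm isCompact_Icc
  refine (hK.image hg.continuous).isBounded.subset ?_
  rintro _ ⟨z, rfl⟩
  have p1 : Function.Periodic g (ℓ : ℂ) := h1
  have p2 : Function.Periodic g (2 * Real.pi * Complex.I) := h2
  refine ⟨z - (⌊z.re / ℓ⌋ : ℤ) * ℓ - (⌊z.im / (2 * Real.pi)⌋ : ℤ) * (2 * Real.pi * Complex.I),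
    ?_, ?_⟩
  · have hpi : 0 < 2 * Real.pi := by positivity
    have a1 := Int.floor_le (z.re / ℓ)
    have a2 := (Int.lt_floor_add_one (z.re / ℓ)).le
    have b1 := Int.floor_le (z.im / (2 * Real.pi))
    have b2 := (Int.lt_floor_add_one (z.im / (2 * Real.pi))).le
    rw [le_div_iff₀ hℓ] at a1
    rw [div_le_iff₀ hℓ] at a2
    rw [le_div_iff₀ hpi] at b1
    rw [div_le_iff₀ hpi] at b2
    rw [Complex.mem_reProdIm]
    simp
    constructor <;> constructor <;> nlinarith
  · rw [p2.sub_int_mul_eq, p1.sub_int_mul_eq]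

lemma eq_const_mul {ℓ : ℝ} (hℓ : 0 < ℓ) {u v : ℂ → ℂ} (hu : Differentiable ℂ u)
    (hv : Differentiable ℂ v) (h : ∀ x, v x = 0 → u x = 0 ∧ deriv v x ≠ 0)
    (hm : ∀ ω : ℂ, ω = ℓ ∨ ω = 2 * Real.pi * Complex.I → ∃ m : ℂ → ℂ, ∀ x, m x ≠ 0 ∧
      u (x + ω) = m x * u x ∧ v (x + ω) = m x * v x) :
    ∃ c : ℂ, ∀ x, u x = c * v x := by
  obtain ⟨g, hg, hgv⟩ := exists_entire_quotient hu hv h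
  have key : ∀ ω : ℂ, ω = ℓ ∨ ω = 2 * Real.pi * Complex.I → ∀ x, g (x + ω) = g x := by
    intro ω hω
    obtain ⟨m, hmm⟩ := hm ω hω
    have off : ∀ x, v x ≠ 0 → g (x + ω) = g x := by
      intro x hx
      obtain ⟨m0, e1, e2⟩ := hmm x
      rw [hgv, hgv x, e2] at e1
      have : m x * v x ≠ 0 := mul_ne_zero m0 hx
      apply mul_right_cancel₀ this
      rw [e1]; ring
    intro p
    by_cases hp : v p = 0
    · have hd : HasDerivAt v (deriv v p) p := (hv p).hasDerivAt
      have hne : ∀ᶠ x in 𝓝[≠] p, v x ≠ 0 := by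
        have := hd.eventually_ne (c := 0) (h p hp).2
        exact this
      have c1 : Tendsto (fun x => g (x + ω)) (𝓝[≠] p) (𝓝 (g (p + ω))) :=
        ((hg.continuous.comp (continuous_id.add continuous_const)).tendsto p).mono_left
          nhdsWithin_le_nhds
      have c2 : Tendsto g (𝓝[≠] p) (𝓝 (g p)) := (hg.continuous.tendsto p).mono_left
          nhdsWithin_le_nhds
      refine tendsto_nhds_unique (c1.congr' ?_) c2
      filter_upwards [hne] with x hx using off x hx
    · exact off p hp
  refine ⟨g 0, fun x => ?_⟩
  rw [hgv x, periodic_const hℓ hg (key _ (Or.inl rfl)) (key _ (Or.inr rfl)) x 0]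

end Analysis

section ThetaLike

open Filter Topology

/-- The period lattice. -/
noncomputable def Lam (ℓ : ℝ) : Set ℂ := lat (ℓ : ℂ) (2 * Real.pi * Complex.I)

lemma Lam_add {ℓ : ℝ} {x y : ℂ} (hx : x ∈ Lam ℓ) (hy : y ∈ Lam ℓ) : x + y ∈ Lam ℓ := by
  obtain ⟨m, n, rfl⟩ := hx
  obtain ⟨m', n', rfl⟩ := hy
  exact ⟨m + m', n + n', by push_cast; ring⟩

lemma Lam_neg {ℓ : ℝ} {x : ℂ} (hx : x ∈ Lam ℓ) : -x ∈ Lam ℓ := by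
  obtain ⟨m, n, rfl⟩ := hx
  exact ⟨-m, -n, by push_cast; ring⟩

lemma Lam_sub {ℓ : ℝ} {x y : ℂ} (hx : x ∈ Lam ℓ) (hy : y ∈ Lam ℓ) : x - y ∈ Lam ℓ := by
  rw [sub_eq_add_neg]; exact Lam_add hx (Lam_neg hy)

lemma Lam_zero (ℓ : ℝ) : (0 : ℂ) ∈ Lam ℓ := ⟨0, 0, by simp⟩

lemma Lam_one (ℓ : ℝ) : (ℓ : ℂ) ∈ Lam ℓ := ⟨1, 0, by simp⟩

lemma Lam_two (ℓ : ℝ) : (2 * Real.pi * Complex.I : ℂ) ∈ Lam ℓ := ⟨0, 1, by simp⟩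

lemma Lam_countable (ℓ : ℝ) : (Lam ℓ).Countable := by
  have : Lam ℓ = Set.range (fun p : ℤ × ℤ => (p.1 : ℂ) * ℓ + (p.2 : ℂ) *
      (2 * Real.pi * Complex.I)) := by
    ext z
    constructor
    · rintro ⟨m, n, rfl⟩
      exact ⟨(m, n), rfl⟩
    · rintro ⟨⟨m, n⟩, rfl⟩
      exact ⟨m, n, rfl⟩
  rw [this]; exact Set.countable_range _

/-- Odd entire functions with theta-type quasi-periodicity and simple zeros at the lattice. -/
structure ThetaLike (ℓ : ℝ) (t : ℂ → ℂ) : Prop where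
  diff : Differentiable ℂ t
  odd : ∀ z, t (-z) = - t z
  quasi : ∀ l ∈ Lam ℓ, ∃ α β : ℂ, α ≠ 0 ∧ ∀ z, t (z + l) = α * Complex.exp (β * z) * t z
  zero : ∀ z, t z = 0 ↔ z ∈ Lam ℓ
  deriv0 : deriv t 0 ≠ 0

namespace ThetaLike

variable {ℓ : ℝ} {t : ℂ → ℂ}

lemma hda (T : ThetaLike ℓ t) (x : ℂ) : HasDerivAt t (deriv t x) x := (T.diff x).hasDerivAt

lemma diff' (T : ThetaLike ℓ t) : Differentiable ℂ (deriv t) := by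
  rw [← differentiableOn_univ]
  exact T.diff.differentiableOn.deriv isOpen_univ

lemma quasi' (T : ThetaLike ℓ t) {l : ℂ} (hl : l ∈ Lam ℓ) : ∃ α β : ℂ, α ≠ 0 ∧
    (∀ z, t (z + l) = α * Complex.exp (β * z) * t z) ∧
    ∀ z, deriv t (z + l) = α * Complex.exp (β * z) * (deriv t z + β * t z) := by
  obtain ⟨α, β, h0, h⟩ := T.quasi l hl
  refine ⟨α, β, h0, h, fun z => ?_⟩
  have h1 : HasDerivAt (fun z => t (z + l)) (deriv t (z + l)) z :=
    (T.hda (z + l)).comp_add_const z l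
  have h2 : HasDerivAt (fun z => α * Complex.exp (β * z) * t z)
      (α * (Complex.exp (β * z) * (β * 1)) * t z + α * Complex.exp (β * z) * deriv t z) z :=
    ((((hasDerivAt_id z).const_mul β).cexp).const_mul α).mul (T.hda z)
  have h3 : (fun z => t (z + l)) = fun z => α * Complex.exp (β * z) * t z := funext h
  rw [h3] at h1
  rw [h1.unique h2]; ring

lemma deriv_ne (T : ThetaLike ℓ t) {l : ℂ} (hl : l ∈ Lam ℓ) : deriv t l ≠ 0 := by
  obtain ⟨α, β, h0, -, h⟩ := T.quasi' hl
  have := h 0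
  rw [zero_add, (T.zero 0).2 (Lam_zero ℓ)] at this
  rw [this]
  simp [h0, T.deriv0]

lemma t_zero (T : ThetaLike ℓ t) : t 0 = 0 := (T.zero 0).2 (Lam_zero ℓ)

lemma deriv_even (T : ThetaLike ℓ t) (x : ℂ) : deriv t (-x) = deriv t x := by
  have h : (fun x => t (-x)) = fun x => - t x := funext T.odd
  have h1 : deriv (fun x => t (-x)) x = - deriv t (-x) := deriv_comp_neg t x
  rw [h, deriv.fun_neg] at h1
  linear_combination h1

/-- left-hand side of the Fay-type identity -/
noncomputable def N (t : ℂ → ℂ) (y a x : ℂ) : ℂ :=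
  deriv t x * t (x + y + a) * t y * t a +
    t x * t (x + y + a) * (deriv t y * t a + t y * deriv t a) -
    t x * deriv t (x + y + a) * t y * t a

lemma fay_generic (hℓ : 0 < ℓ) (T : ThetaLike ℓ t) {y a : ℂ} (hy : y ∉ Lam ℓ) (ha : a ∉ Lam ℓ)
    (hya : y - a ∉ Lam ℓ) (x : ℂ) :
    N t y a x = deriv t 0 * t (x + y) * t (x + a) * t (y + a) := by
  have d0 := T.diff
  have d1 := T.diff'
  have hquasi : ∀ l ∈ Lam ℓ, ∃ m : ℂ → ℂ, ∀ x, m x ≠ 0 ∧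
      N t y a (x + l) = m x * N t y a x ∧
        t (x + l + y) * t (x + l + a) = m x * (t (x + y) * t (x + a)) := by
    intro l hl
    obtain ⟨α, β, h0, h, h'⟩ := T.quasi' hl
    refine ⟨fun x => α ^ 2 * (Complex.exp (β * x) * Complex.exp (β * x) *
      Complex.exp (β * y) * Complex.exp (β * a)), fun x => ⟨?_, ?_, ?_⟩⟩
    · simp [h0, Complex.exp_ne_zero]
    · unfold N
      rw [show x + l + y + a = x + y + a + l by ring, h, h, h', h',
        show β * (x + y + a) = β * x + β * y + β * a by ring, Complex.exp_add, Complex.exp_add]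
      ring
    · rw [show x + l + y = x + y + l by ring, show x + l + a = x + a + l by ring, h, h,
        mul_add, mul_add, Complex.exp_add, Complex.exp_add]
      ring
  have hNy : N t y a (-y) = 0 := by
    unfold N
    rw [show -y + y + a = a by ring, T.odd, T.deriv_even]
    ring
  have hNa : N t y a (-a) = 0 := by
    unfold N
    rw [show -a + y + a = y by ring, T.odd, T.deriv_even]
    ring
  have hz : ∀ l ∈ Lam ℓ, ∀ x, N t y a x = 0 → N t y a (x + l) = 0 := by
    intro l hl x hx
    obtain ⟨m, hm⟩ := hquasi l hl
    rw [(hm x).2.1, hx, mul_zero]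
  obtain ⟨c, hc⟩ := eq_const_mul hℓ (u := N t y a) (v := fun x => t (x + y) * t (x + a))
    (by unfold N; fun_prop) (by fun_prop) (by
      intro x hx
      have hder : deriv (fun x => t (x + y) * t (x + a)) x =
          deriv t (x + y) * t (x + a) + t (x + y) * deriv t (x + a) :=
        (((T.hda (x + y)).comp_add_const x y).mul ((T.hda (x + a)).comp_add_const x a)).deriv
      rw [hder]
      rcases mul_eq_zero.1 hx with hx | hx
      · have hl := (T.zero _).1 hx
        refine ⟨?_, ?_⟩
        · have := hz _ hl _ hNy
          rwa [show -y + (x + y) = x by ring] at this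
        · rw [hx, zero_mul, add_zero]
          refine mul_ne_zero (T.deriv_ne hl) ?_
          intro h
          have h2 := (T.zero _).1 h
          apply hya
          have := Lam_sub hl h2
          rwa [show x + y - (x + a) = y - a by ring] at this
      · have hl := (T.zero _).1 hx
        refine ⟨?_, ?_⟩
        · have := hz _ hl _ hNa
          rwa [show -a + (x + a) = x by ring] at this
        · rw [hx, mul_zero, zero_add]
          refine mul_ne_zero ?_ (T.deriv_ne hl)
          intro h
          have h2 := (T.zero _).1 h
          apply hya
          have := Lam_sub h2 hl
          rwa [show x + y - (x + a) = y - a by ring] at this)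
    (by
      rintro ω (rfl | rfl)
      · exact hquasi _ (Lam_one ℓ)
      · exact hquasi _ (Lam_two ℓ))
  have hc0 : c = deriv t 0 * t (y + a) := by
    have h := hc 0
    have hya0 : t y * t a ≠ 0 := mul_ne_zero (mt (T.zero _).1 hy) (mt (T.zero _).1 ha)
    simp only [N, zero_add, T.t_zero, zero_mul, add_zero, sub_zero] at h
    apply mul_right_cancel₀ hya0
    rw [← h]; ring
  rw [hc x, hc0]; ring

lemma fay (hℓ : 0 < ℓ) (T : ThetaLike ℓ t) {a : ℂ} (ha : a ∉ Lam ℓ) (x y : ℂ) :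
    N t y a x = deriv t 0 * t (x + y) * t (x + a) * t (y + a) := by
  have d0 := T.diff.continuous
  have d1 := T.diff'.continuous
  have hcount : (Lam ℓ ∪ (fun l => l + a) '' Lam ℓ).Countable :=
    (Lam_countable ℓ).union ((Lam_countable ℓ).image _)
  have hdense := hcount.dense_compl ℂ
  have : (fun y => N t y a x) = fun y => deriv t 0 * t (x + y) * t (x + a) * t (y + a) := by
    refine Continuous.ext_on hdense (by unfold N; fun_prop) (by fun_prop) ?_
    intro y hy
    simp only [Set.mem_compl_iff, Set.mem_union, not_or] at hy
    refine fay_generic hℓ T hy.1 ha (fun h => hy.2 ⟨_, h, by ring⟩) x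
  exact congrFun this y

/-- Kronecker function. -/
noncomputable def F (t : ℂ → ℂ) (a x : ℂ) : ℂ := deriv t 0 * t (x + a) / (t x * t a)

/-- its derivative in `a`. -/
noncomputable def DF (t : ℂ → ℂ) (a x : ℂ) : ℂ :=
  deriv t 0 * (deriv t (x + a) * t a - t (x + a) * deriv t a) / (t x * t a ^ 2)

/-- logarithmic derivative -/
noncomputable def H (t : ℂ → ℂ) (x : ℂ) : ℂ := deriv t x / t x

/-- derivative of the logarithmic derivative -/
noncomputable def H' (t : ℂ → ℂ) (x : ℂ) : ℂ := (deriv (deriv t) x * t x - deriv t x * deriv t x) / t x ^ 2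

lemma H_odd (T : ThetaLike ℓ t) (x : ℂ) : H t (-x) = - H t x := by
  unfold H; rw [T.odd, T.deriv_even, div_neg]

lemma H_hasDeriv (T : ThetaLike ℓ t) {x : ℂ} (hx : x ∉ Lam ℓ) : HasDerivAt (H t) (H' t x) x :=
  (T.diff' x).hasDerivAt.div (T.hda x) (mt (T.zero _).1 hx)

lemma F_hasDeriv (T : ThetaLike ℓ t) {x a : ℂ} (hx : x ∉ Lam ℓ) (ha : a ∉ Lam ℓ) :
    HasDerivAt (fun a => F t a x) (DF t a x) a := by
  have hx := mt (T.zero _).1 hx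
  have ha := mt (T.zero _).1 ha
  have h1 : HasDerivAt (fun a => deriv t 0 * t (x + a)) (deriv t 0 * deriv t (x + a)) a :=
    ((T.hda (x + a)).comp_const_add x a).const_mul _
  have h2 := h1.div ((T.hda a).const_mul (t x)) (mul_ne_zero hx ha)
  refine h2.congr_deriv ?_
  unfold DF
  field_simp

lemma F_fay (hℓ : 0 < ℓ) (T : ThetaLike ℓ t) {x y a : ℂ} (ha : a ∉ Lam ℓ) (hx : x ∉ Lam ℓ)
    (hy : y ∉ Lam ℓ) (hxy : x + y ∉ Lam ℓ) :
    F t a x * F t a y = F t a (x + y) * (H t x + H t y) - DF t a (x + y) := by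
  have h := fay hℓ T ha x y
  have hx := mt (T.zero _).1 hx
  have hy := mt (T.zero _).1 hy
  have ha := mt (T.zero _).1 ha
  have hxy := mt (T.zero _).1 hxy
  unfold F DF H
  unfold N at h
  field_simp
  linear_combination (-deriv t 0) * h

lemma F_two (hℓ : 0 < ℓ) (T : ThetaLike ℓ t) {y a : ℂ} (ha : a ∉ Lam ℓ) (hy : y ∉ Lam ℓ) :
    F t a y * F t a (-y) = H' t y - H' t a := by
  have h : N t y a = fun x => deriv t 0 * t (x + y) * t (x + a) * t (y + a) :=
    funext fun x => fay hℓ T ha x y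
  have hy := mt (T.zero _).1 hy
  have ha := mt (T.zero _).1 ha
  have e1 : HasDerivAt (N t y a)
      (deriv (deriv t) (-y) * t (-y + y + a) * t y * t a +
        deriv t (-y) * deriv t (-y + y + a) * t y * t a +
       (deriv t (-y) * t (-y + y + a) + t (-y) * deriv t (-y + y + a)) *
          (deriv t y * t a + t y * deriv t a) -
       (deriv t (-y) * deriv t (-y + y + a) + t (-y) * deriv (deriv t) (-y + y + a)) *
          t y * t a) (-y) := by
    have a1 := T.hda (-y)
    have a2 := (T.diff' (-y)).hasDerivAt
    have a3 : HasDerivAt (fun x => t (x + y + a)) (deriv t (-y + y + a)) (-y) := by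
      simp only [add_assoc]
      exact (T.hda _).comp_add_const (-y) (y + a)
    have a4 : HasDerivAt (fun x => deriv t (x + y + a)) (deriv (deriv t) (-y + y + a)) (-y) := by
      simp only [add_assoc]
      exact (T.diff' _).hasDerivAt.comp_add_const (-y) (y + a)
    have := ((((a2.mul a3).mul_const (t y)).mul_const (t a)).add
      ((a1.mul a3).mul_const (deriv t y * t a + t y * deriv t a))).sub
      (((a1.mul a4).mul_const (t y)).mul_const (t a))
    refine this.congr_deriv ?_
    ring
  have e2 : HasDerivAt (fun x => deriv t 0 * t (x + y) * t (x + a) * t (y + a))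
      ((deriv t 0 * deriv t (-y + y) * t (-y + a) + deriv t 0 * t (-y + y) * deriv t (-y + a)) *
        t (y + a)) (-y) :=
    ((((T.hda _).comp_add_const (-y) y).const_mul (deriv t 0)).mul
      ((T.hda _).comp_add_const (-y) a)).mul_const _
  rw [h] at e1
  have e := e1.unique e2
  have hdd : deriv (deriv t) (-y) = - deriv (deriv t) y := by
    have h : (fun x => deriv t (-x)) = deriv t := funext T.deriv_even
    have h1 : deriv (fun x => deriv t (-x)) y = - deriv (deriv t) (-y) := deriv_comp_neg _ y
    rw [h] at h1
    rw [h1, neg_neg]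
  rw [neg_add_cancel, zero_add, T.t_zero, T.odd y, T.deriv_even, hdd] at e
  unfold F H'
  rw [T.odd y]
  field_simp
  linear_combination e

end ThetaLike

end ThetaLike

section Weier

open Filter Topology

/-- The period pair `(ℓ, 2πi)`. -/
noncomputable def PP (ℓ : ℝ) (hℓ : 0 < ℓ) : PeriodPair where
  ω₁ := ℓ
  ω₂ := 2 * Real.pi * Complex.I
  indep := by
    rw [LinearIndependent.pair_iff]
    intro s t h
    have h1 := congrArg Complex.re h
    have h2 := congrArg Complex.im h
    simp at h1 h2
    exact ⟨h1.resolve_right hℓ.ne', h2⟩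

lemma mem_PP {ℓ : ℝ} (hℓ : 0 < ℓ) (x : ℂ) : x ∈ (PP ℓ hℓ).lattice ↔ x ∈ Lam ℓ := by
  rw [PeriodPair.mem_lattice]
  constructor
  · rintro ⟨m, n, h⟩; exact ⟨m, n, h.symm⟩
  · rintro ⟨m, n, h⟩; exact ⟨m, n, h.symm⟩

lemma wp_eq {ℓ : ℝ} (hℓ : 0 < ℓ) :
    wp (ℓ : ℂ) (2 * Real.pi * Complex.I) = (PP ℓ hℓ).weierstrassP := by
  funext z
  have hs := ((PP ℓ hℓ).hasSum_weierstrassP z)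
  rw [← (PP ℓ hℓ).latticeEquivProd.symm.toEquiv.hasSum_iff] at hs
  have e := hs.summable.sum_add_tsum_subtype_compl {0}
  rw [← hs.tsum_eq, ← e]
  unfold wp
  congr 1
  · simp
  · rw [← (Equiv.subtypeEquivRight (p := fun p : ℤ × ℤ => p ≠ 0)
      (q := fun p => p ∉ ({0} : Finset (ℤ × ℤ))) (by simp)).tsum_eq]
    refine tsum_congr fun p => ?_
    simp only [Function.comp]
    have := (PP ℓ hℓ).latticeEquiv_symm_apply p.1
    simp only [LinearEquiv.coe_toEquiv, Equiv.subtypeEquivRight_apply_coe]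
    erw [this]
    rfl

namespace ThetaLike

variable {ℓ : ℝ} {t : ℂ → ℂ}

lemma H'_periodic (T : ThetaLike ℓ t) {l : ℂ} (hl : l ∈ Lam ℓ) {x : ℂ} (hx : x ∉ Lam ℓ) :
    H' t (x + l) = H' t x := by
  obtain ⟨α, β, h0, h, h'⟩ := T.quasi' hl
  have hxl : x + l ∉ Lam ℓ := fun hh => hx (by simpa using Lam_sub hh hl)
  have hne : ∀ᶠ y in 𝓝 x, t y ≠ 0 :=
    T.diff.continuous.continuousAt.eventually_ne (mt (T.zero _).1 hx)
  have h1 : HasDerivAt (fun y => H t (y + l)) (H' t (x + l)) x :=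
    (T.H_hasDeriv hxl).comp_add_const x l
  have h2 : HasDerivAt (fun y => H t y + β) (H' t x) x := (T.H_hasDeriv hx).add_const β
  refine h1.unique (h2.congr_of_eventuallyEq ?_)
  filter_upwards [hne] with y hy
  unfold H
  rw [h, h']
  have := Complex.exp_ne_zero (β * y)
  field_simp

lemma H'_add_wp (hℓ : 0 < ℓ) (T : ThetaLike ℓ t) :
    ∃ C : ℂ, ∀ a, a ∉ Lam ℓ → H' t a = C - (PP ℓ hℓ).weierstrassP a := by
  classical
  set L := PP ℓ hℓ with hL
  set s := dslope t 0 with hs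
  have hsd : Differentiable ℂ s := differentiable_dslope' T.diff 0
  have hsd' : Differentiable ℂ (deriv s) := by
    rw [← differentiableOn_univ]
    exact hsd.differentiableOn.deriv isOpen_univ
  have hs0 : s 0 ≠ 0 := by rw [hs, dslope_same]; exact T.deriv0
  have hts : ∀ x, t x = x * s x := fun x => by
    have := eq_sub_mul_dslope T.t_zero x
    rwa [sub_zero] at this
  have htd : ∀ x, deriv t x = s x + x * deriv s x := fun x => by
    have h1 : HasDerivAt (fun x => x * s x) (1 * s x + x * deriv s x) x :=
      (hasDerivAt_id x).mul (hsd x).hasDerivAt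
    have : t = fun x => x * s x := funext hts
    rw [this, h1.deriv]; ring
  -- local model at the origin
  let r : ℂ → ℂ := fun x => deriv (fun y => deriv s y / s y) x + L.weierstrassPExcept 0 x
  have hsne : ∀ᶠ x in 𝓝 (0 : ℂ), s x ≠ 0 := hsd.continuous.continuousAt.eventually_ne hs0
  have hr : DifferentiableAt ℂ r 0 := by
    have h1 : AnalyticAt ℂ (fun y => deriv s y / s y) 0 :=
      (hsd'.analyticAt 0).div (hsd.analyticAt 0) hs0
    exact h1.deriv.differentiableAt.add (L.analyticAt_weierstrassPExcept 0).differentiableAt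
  have hmodel : ∀ᶠ x in 𝓝 (0 : ℂ), x ≠ 0 → x ∉ Lam ℓ ∧ H' t x + L.weierstrassP x = r x := by
    filter_upwards [hsne.eventually_nhds] with x hx hx0
    have hxs : s x ≠ 0 := hx.self_of_nhds
    have hxL : x ∉ Lam ℓ := fun h => by
      have := (T.zero x).2 h
      rw [hts] at this
      exact mul_ne_zero hx0 hxs this
    refine ⟨hxL, ?_⟩
    have e1 : L.weierstrassP x = L.weierstrassPExcept 0 x + 1 / x ^ 2 := by
      have := L.weierstrassPExcept_add 0 x
      rw [← this]
      simp
    have h1 := T.H_hasDeriv hxL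
    have h2 : HasDerivAt (fun y => y⁻¹ + deriv s y / s y)
        (-(x ^ 2)⁻¹ + deriv (fun y => deriv s y / s y) x) x := by
      refine (hasDerivAt_inv hx0).add (DifferentiableAt.hasDerivAt ?_)
      exact (hsd' x).div (hsd x) hxs
    have h3 := h1.unique (h2.congr_of_eventuallyEq (by
      filter_upwards [hx, eventually_ne_nhds hx0] with y hy hy0
      unfold H
      rw [hts, htd]
      field_simp))
    rw [h3, e1]
    simp only [r]
    ring
  let k : ℂ → ℂ := fun x => if x ∈ Lam ℓ then r 0 else H' t x + L.weierstrassP x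
  have hk0 : DifferentiableAt ℂ k 0 := by
    refine hr.congr_of_eventuallyEq ?_
    filter_upwards [hmodel] with x hx
    by_cases hx0 : x = 0
    · simp [k, hx0, Lam_zero]
    · simp [k, (hx hx0).1, (hx hx0).2]
  have hper : ∀ l ∈ Lam ℓ, ∀ x, k (x + l) = k x := by
    intro l hl x
    by_cases hx : x ∈ Lam ℓ
    · simp [k, hx, Lam_add hx hl]
    · have hxl : x + l ∉ Lam ℓ := fun hh => hx (by simpa using Lam_sub hh hl)
      simp only [k, hx, hxl, if_false]
      rw [T.H'_periodic hl hx]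
      have := L.weierstrassP_add_coe x ⟨l, (mem_PP hℓ l).2 hl⟩
      simp only at this
      rw [this]
  have hk : Differentiable ℂ k := by
    intro p
    by_cases hp : p ∈ Lam ℓ
    · have : k = fun x => k (x + -p) := funext fun x => (hper _ (Lam_neg hp) x).symm
      have h0 : DifferentiableAt ℂ k (p + -p) := by rw [add_neg_cancel]; exact hk0
      have h1 : DifferentiableAt ℂ (fun x => k (x + -p)) p :=
        DifferentiableAt.comp (g := k) (f := fun x => x + -p) p h0 (by fun_prop)
      exact this ▸ h1
    · have hne : ∀ᶠ y in 𝓝 p, t y ≠ 0 :=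
        T.diff.continuous.continuousAt.eventually_ne (mt (T.zero _).1 hp)
      have hd : DifferentiableAt ℂ (fun x => H' t x + L.weierstrassP x) p := by
        have hdd : Differentiable ℂ (deriv (deriv t)) := by
          rw [← differentiableOn_univ]
          exact T.diff'.differentiableOn.deriv isOpen_univ
        have d0 := T.diff
        have d1 := T.diff'
        have htp : t p ^ 2 ≠ 0 := pow_ne_zero 2 (mt (T.zero _).1 hp)
        refine DifferentiableAt.add ?_ ?_
        · unfold H'
          exact DifferentiableAt.div (by fun_prop) (by fun_prop) htp
        · refine L.differentiableOn_weierstrassP.differentiableAt ?_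
          refine L.isClosed_lattice.isOpen_compl.mem_nhds ?_
          exact mt (mem_PP hℓ p).1 hp
      refine hd.congr_of_eventuallyEq ?_
      filter_upwards [hne] with x hx
      have : x ∉ Lam ℓ := mt (T.zero x).2 hx
      simp [k, this]
  refine ⟨k 0, fun a ha => ?_⟩
  have := periodic_const hℓ hk (hper _ (Lam_one ℓ)) (hper _ (Lam_two ℓ)) 0 a
  rw [this]
  simp [k, ha]

lemma Lam_compl_nhds {ℓ : ℝ} (hℓ : 0 < ℓ) {a : ℂ} (ha : a ∉ Lam ℓ) : ∀ᶠ x in 𝓝 a, x ∉ Lam ℓ := by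
  have := (PP ℓ hℓ).isClosed_lattice.isOpen_compl.mem_nhds (x := a) (mt (mem_PP hℓ a).1 ha)
  filter_upwards [this] with x hx
  exact mt (mem_PP hℓ x).2 hx

lemma cycleSum_step (hℓ : 0 < ℓ) (T : ThetaLike ℓ t) {n : ℕ} (hn : 2 ≤ n) (z : Fin (n + 1) → ℂ)
    (hz : ∀ j k, j ≠ k → z j - z k ∉ Lam ℓ) (G : ℂ → ℂ)
    (hG : ∀ a, a ∉ Lam ℓ → cycleSum n (F t a) (fun i => z i.succ) = G a) {a : ℂ}
    (ha : a ∉ Lam ℓ) :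
    cycleSum (n + 1) (F t a) z = - deriv G a := by
  classical
  rw [cycleSum_rec hn (F t a) (H t) (DF t a) z T.H_odd]
  · congr 1
    symm
    have hev : G =ᶠ[𝓝 a] fun a => cycleSum n (F t a) (fun i => z i.succ) := by
      filter_upwards [Lam_compl_nhds hℓ ha] with x hx using (hG x hx).symm
    rw [hev.deriv_eq]
    apply HasDerivAt.deriv
    simp only [cycleSum_eq hn]
    have : ∀ τ ∈ Finset.univ.filter (fun σ : Equiv.Perm (Fin n) => FullCyc σ),
        HasDerivAt (fun a => ∏ k, F t a (z (τ k).succ - z k.succ))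
        (∑ j : Fin n, DF t a (z (τ j).succ - z j.succ) *
        ∏ k ∈ Finset.univ.erase j, F t a (z (τ k).succ - z k.succ)) a := by
      intro τ hτ
      have hτ : FullCyc τ := by simpa using hτ
      have hne : ∀ j, τ j ≠ j := fun j hj => by
        have := ((fullCyc_iff hn τ).2 hτ).2
        have h2 : j ∈ τ.support := by rw [this]; exact Finset.mem_univ j
        exact Equiv.Perm.mem_support.1 h2 hj
      have := HasDerivAt.fun_finsetProd (u := Finset.univ) (x := a)
        (f := fun (k : Fin n) a => F t a (z (τ k).succ - z k.succ))
        (f' := fun k => DF t a (z (τ k).succ - z k.succ))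
        (fun k _ => T.F_hasDeriv (hz _ _ (by simpa using hne k)) ha)
      refine this.congr_deriv ?_
      refine Finset.sum_congr rfl fun j _ => ?_
      rw [smul_eq_mul, mul_comm]
    convert HasDerivAt.fun_sum this
  · intro i j hij
    have h1 := hz i.succ 0 (Fin.succ_ne_zero i)
    have h2 := hz 0 j.succ (Fin.succ_ne_zero j).symm
    have h3 := hz i.succ j.succ (by simpa using hij)
    have e : z i.succ - z j.succ = (z i.succ - z 0) + (z 0 - z j.succ) := by ring
    rw [e] at h3 ⊢
    exact T.F_fay hℓ ha h1 h2 h3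

lemma cycleSum_main (hℓ : 0 < ℓ) (T : ThetaLike ℓ t) (k : ℕ) (z : Fin (k + 3) → ℂ)
    (hz : ∀ i j, i ≠ j → z i - z j ∉ Lam ℓ) (a : ℂ) (ha : a ∉ Lam ℓ) :
    cycleSum (k + 3) (F t a) z =
      (-1) ^ (k + 3) * iteratedDeriv (k + 1) (PP ℓ hℓ).weierstrassP a := by
  induction k generalizing a with
  | zero =>
    obtain ⟨C, hC⟩ := T.H'_add_wp hℓ
    have hz' : z 2 - z 1 ∉ Lam ℓ := hz _ _ (by decide)
    rw [T.cycleSum_step hℓ le_rfl z hz (fun a => (PP ℓ hℓ).weierstrassP a -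
      (PP ℓ hℓ).weierstrassP (z 2 - z 1)) ?_ ha, deriv_sub_const]
    · rw [zero_add, iteratedDeriv_one]; ring
    · intro b hb
      rw [cycleSum_two]
      have := T.F_two hℓ hb hz'
      rw [hC _ hz', hC _ hb, neg_sub] at this
      have e : ((1 : Fin 2).succ) = (2 : Fin 3) := rfl
      have e' : ((0 : Fin 2).succ) = (1 : Fin 3) := rfl
      rw [e, e', this]; ring
  | succ k ih =>
    rw [T.cycleSum_step hℓ (by omega) z hz (fun a => (-1) ^ (k + 3) *
      iteratedDeriv (k + 1) (PP ℓ hℓ).weierstrassP a) ?_ ha, deriv_const_mul_field]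
    · rw [iteratedDeriv_succ (n := k + 1)]; ring
    · intro b hb
      exact ih _ (fun i j hij => hz _ _ (by simpa using hij)) b hb

end ThetaLike

end Weier

section ProdSec

open Filter Topology

/-- The infinite product `∏ (1 - Qⁿ x)`. -/
noncomputable def Aq (Q x : ℂ) : ℂ := ∏' n : ℕ, (1 + -(Q ^ n * x))

lemma Aq_summable {Q : ℂ} (hQ : ‖Q‖ < 1) (x : ℂ) : Summable fun n : ℕ => ‖-(Q ^ n * x)‖ := by
  simp only [norm_neg, norm_mul, norm_pow]
  exact (summable_geometric_of_lt_one (norm_nonneg _) hQ).mul_right _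

lemma Aq_diff {Q : ℂ} (hQ : ‖Q‖ < 1) : Differentiable ℂ (Aq Q) := by
  have h : HasProdLocallyUniformlyOn (fun (n : ℕ) (x : ℂ) => 1 + -(Q ^ n * x)) (Aq Q)
      Set.univ := by
    apply hasProdLocallyUniformlyOn_of_forall_compact isOpen_univ
    intro K _ hcK
    obtain ⟨C, hC⟩ := hcK.isBounded.exists_norm_le
    refine ((summable_geometric_of_lt_one (norm_nonneg _) hQ).mul_right
      C).hasProdUniformlyOn_nat_one_add hcK (.of_forall fun n x hx => ?_) (fun _ => by fun_prop)
    rw [norm_neg, norm_mul, norm_pow]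
    exact mul_le_mul_of_nonneg_left (hC x hx) (by positivity)
  rw [← differentiableOn_univ]
  exact h.differentiableOn
    (.of_forall fun _ => by simpa [Finset.prod_fn] using
      DifferentiableOn.finsetProd (fun _ _ => by fun_prop)) isOpen_univ

lemma Aq_step {Q : ℂ} (hQ : ‖Q‖ < 1) (x : ℂ) : Aq Q x = (1 - x) * Aq Q (Q * x) := by
  unfold Aq
  have h2 : Multipliable fun n : ℕ => 1 + -(Q ^ (n + 1) * x) := by
    refine multipliable_one_add_of_summable ?_
    exact (summable_nat_add_iff (f := fun n : ℕ => ‖-(Q ^ n * x)‖) 1).2 (Aq_summable hQ x)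
  rw [tprod_eq_zero_mul' (f := fun n : ℕ => 1 + -(Q ^ n * x)) h2]
  simp only [pow_zero, one_mul, pow_succ, mul_assoc, sub_eq_add_neg]

lemma Aq_ne {Q : ℂ} (hQ : ‖Q‖ < 1) {x : ℂ} (h : ∀ n : ℕ, Q ^ n * x ≠ 1) : Aq Q x ≠ 0 := by
  refine tprod_one_add_ne_zero_of_summable (f := fun n : ℕ => -(Q ^ n * x)) ?_ (Aq_summable hQ x)
  intro i hi
  exact h i (by linear_combination -hi)

lemma quasi_of_gen {ℓ : ℝ} {t : ℂ → ℂ}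
    (h1 : ∃ α β : ℂ, α ≠ 0 ∧ ∀ z, t (z + ℓ) = α * Complex.exp (β * z) * t z)
    (h2 : ∃ α β : ℂ, α ≠ 0 ∧ ∀ z, t (z + 2 * Real.pi * Complex.I) =
      α * Complex.exp (β * z) * t z) :
    ∀ l ∈ Lam ℓ, ∃ α β : ℂ, α ≠ 0 ∧ ∀ z, t (z + l) = α * Complex.exp (β * z) * t z := by
  let S : AddSubgroup ℂ :=
    { carrier := {l | ∃ α β : ℂ, α ≠ 0 ∧ ∀ z, t (z + l) = α * Complex.exp (β * z) * t z}
      zero_mem' := ⟨1, 0, one_ne_zero, by simp⟩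
      add_mem' := by
        rintro a b ⟨α, β, hα, ha⟩ ⟨γ, δ, hγ, hb⟩
        refine ⟨α * γ * Complex.exp (δ * a), β + δ,
          mul_ne_zero (mul_ne_zero hα hγ) (Complex.exp_ne_zero _), fun z => ?_⟩
        rw [← add_assoc, hb, ha, mul_add, add_mul, Complex.exp_add, Complex.exp_add]
        ring
      neg_mem' := by
        rintro a ⟨α, β, hα, ha⟩
        refine ⟨α⁻¹ * Complex.exp (β * a), -β,
          mul_ne_zero (inv_ne_zero hα) (Complex.exp_ne_zero _), fun z => ?_⟩
        have := ha (z + -a)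
        rw [neg_add_cancel_right] at this
        rw [this]
        have e : Complex.exp (β * a) * Complex.exp (-β * z) * Complex.exp (β * (z + -a)) = 1 := by
          rw [← Complex.exp_add, ← Complex.exp_add, ← Complex.exp_zero]
          congr 1; ring
        have hi : α⁻¹ * α = 1 := inv_mul_cancel₀ hα
        linear_combination (-t (z + -a) * α⁻¹ * α) * e - t (z + -a) * hi }
  rintro l ⟨m, n, rfl⟩
  have hm : (ℓ : ℂ) ∈ S := h1
  have hn : (2 * Real.pi * Complex.I : ℂ) ∈ S := by
    obtain ⟨α, β, hα, h⟩ := h2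
    exact ⟨α, β, hα, h⟩
  have := S.add_mem (S.zsmul_mem hm m) (S.zsmul_mem hn n)
  simp only [zsmul_eq_mul] at this
  exact this

/-- `Q = exp(2πiτ)`. -/
noncomputable def Qq (ℓ : ℝ) : ℂ := Complex.exp (2 * Real.pi * Complex.I * tau ℓ)

lemma tau_eq (ℓ : ℝ) : tau ℓ = ((2 * Real.pi / ℓ : ℝ) : ℂ) * Complex.I := by
  unfold tau; push_cast; ring

lemma tau_im {ℓ : ℝ} (hℓ : 0 < ℓ) : 0 < (tau ℓ).im := by
  rw [tau_eq]
  simp only [Complex.im_ofReal_mul, Complex.I_im, mul_one]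
  positivity

lemma norm_Qq {ℓ : ℝ} (hℓ : 0 < ℓ) : ‖Qq ℓ‖ < 1 := by
  have e : 2 * Real.pi * Complex.I * tau ℓ = ((-(2 * Real.pi * (2 * Real.pi / ℓ)) : ℝ) : ℂ) := by
    rw [tau_eq]; push_cast
    linear_combination (2 * Real.pi * (2 * Real.pi / ℓ) : ℂ) * Complex.I_mul_I
  rw [Qq, e, Complex.norm_exp_ofReal, Real.exp_lt_one_iff]
  have : 0 < 2 * Real.pi * (2 * Real.pi / ℓ) := by positivity
  linarith

/-- `X(z) = exp(2πiz/ℓ)`. -/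
noncomputable def Xx (ℓ : ℝ) (z : ℂ) : ℂ := Complex.exp (2 * Real.pi * Complex.I * z / ℓ)

lemma Xx_ne (ℓ : ℝ) (z : ℂ) : Xx ℓ z ≠ 0 := Complex.exp_ne_zero _

lemma Xx_neg (ℓ : ℝ) (z : ℂ) : Xx ℓ (-z) = (Xx ℓ z)⁻¹ := by
  rw [Xx, Xx, ← Complex.exp_neg]; congr 1; ring

lemma Xx_one {ℓ : ℝ} (hℓ : 0 < ℓ) (z : ℂ) : Xx ℓ (z + ℓ) = Xx ℓ z := by
  have : (ℓ : ℂ) ≠ 0 := by exact_mod_cast hℓ.ne'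
  rw [Xx, Xx, ← Complex.exp_periodic (2 * Real.pi * Complex.I * z / ℓ)]
  congr 1; field_simp

lemma Xx_two (ℓ : ℝ) (z : ℂ) :
    Xx ℓ (z + 2 * Real.pi * Complex.I) = Qq ℓ * Xx ℓ z := by
  rw [Xx, Xx, Qq, tau, ← Complex.exp_add]
  congr 1; ring

/-- Product form of the theta function. -/
noncomputable def vv (ℓ : ℝ) (z : ℂ) : ℂ :=
  Complex.exp (-(Real.pi * Complex.I * z / ℓ)) *
    (Aq (Qq ℓ) (Xx ℓ z) * Aq (Qq ℓ) (Qq ℓ * Xx ℓ (-z)))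

lemma Aq_flip {Q X : ℂ} (hQ : ‖Q‖ < 1) (hX : X ≠ 0) :
    Aq Q (Q * X) * Aq Q X⁻¹ = - X⁻¹ * (Aq Q X * Aq Q (Q * X⁻¹)) := by
  rw [Aq_step hQ X⁻¹, Aq_step hQ X]
  field_simp
  ring

lemma vv_odd {ℓ : ℝ} (hℓ : 0 < ℓ) (z : ℂ) : vv ℓ (-z) = - vv ℓ z := by
  have h := Aq_flip (norm_Qq hℓ) (Xx_ne ℓ z)
  have e : Complex.exp (-(Real.pi * Complex.I * -z / ℓ)) * (Xx ℓ z)⁻¹ =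
      Complex.exp (-(Real.pi * Complex.I * z / ℓ)) := by
    rw [← Xx_neg, Xx, ← Complex.exp_add]; congr 1; ring
  unfold vv
  rw [neg_neg, Xx_neg]
  linear_combination Complex.exp (-(Real.pi * Complex.I * -z / ℓ)) * h -
    (Aq (Qq ℓ) (Xx ℓ z) * Aq (Qq ℓ) (Qq ℓ * (Xx ℓ z)⁻¹)) * e

lemma vv_one {ℓ : ℝ} (hℓ : 0 < ℓ) (z : ℂ) : vv ℓ (z + ℓ) = - vv ℓ z := by
  have hl : (ℓ : ℂ) ≠ 0 := by exact_mod_cast hℓ.ne'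
  have e : Complex.exp (-(Real.pi * Complex.I * (z + ℓ) / ℓ)) =
      - Complex.exp (-(Real.pi * Complex.I * z / ℓ)) := by
    have : -(Real.pi * Complex.I * (z + ℓ) / ℓ) =
      -(Real.pi * Complex.I * z / ℓ) - Real.pi * Complex.I := by field_simp; ring
    rw [this, Complex.exp_sub, Complex.exp_pi_mul_I]; ring
  unfold vv
  rw [Xx_neg, Xx_neg, Xx_one hℓ, e]; ring

lemma vv_two {ℓ : ℝ} (hℓ : 0 < ℓ) (z : ℂ) : vv ℓ (z + 2 * Real.pi * Complex.I) =
    - Complex.exp (-(Real.pi * Complex.I * tau ℓ) - 2 * Real.pi * Complex.I * z / ℓ) *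
      vv ℓ z := by
  have h := Aq_flip (norm_Qq hℓ) (Xx_ne ℓ z)
  have hQ : Qq ℓ ≠ 0 := Complex.exp_ne_zero _
  have e : Complex.exp (-(Real.pi * Complex.I * (z + 2 * Real.pi * Complex.I) / ℓ)) *
      (Xx ℓ z)⁻¹ = Complex.exp (-(Real.pi * Complex.I * tau ℓ) -
        2 * Real.pi * Complex.I * z / ℓ) * Complex.exp (-(Real.pi * Complex.I * z / ℓ)) := by
    rw [← Xx_neg, Xx, ← Complex.exp_add, ← Complex.exp_add, tau]; congr 1; ring
  unfold vv
  rw [Xx_neg, Xx_neg, Xx_two, mul_inv, mul_inv_cancel_left₀ hQ, h]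
  linear_combination - (Aq (Qq ℓ) (Xx ℓ z) * Aq (Qq ℓ) (Qq ℓ * (Xx ℓ z)⁻¹)) * e

lemma Xx_diff (ℓ : ℝ) : Differentiable ℂ (Xx ℓ) := by unfold Xx; fun_prop

lemma vv_diff {ℓ : ℝ} (hℓ : 0 < ℓ) : Differentiable ℂ (vv ℓ) := by
  have hA := Aq_diff (norm_Qq hℓ)
  have hX := Xx_diff ℓ
  unfold vv
  fun_prop

lemma vv_deriv0 {ℓ : ℝ} (hℓ : 0 < ℓ) : deriv (vv ℓ) 0 ≠ 0 := by
  have hl : (ℓ : ℂ) ≠ 0 := by exact_mod_cast hℓ.ne'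
  have hA := Aq_diff (norm_Qq hℓ)
  have hX := Xx_diff ℓ
  let R : ℂ → ℂ := fun z => Complex.exp (-(Real.pi * Complex.I * z / ℓ)) *
    (Aq (Qq ℓ) (Qq ℓ * Xx ℓ z) * Aq (Qq ℓ) (Qq ℓ * Xx ℓ (-z)))
  have hR : Differentiable ℂ R := by fun_prop
  have e : vv ℓ = fun z => (1 - Xx ℓ z) * R z := by
    funext z
    unfold vv
    rw [Aq_step (norm_Qq hℓ) (Xx ℓ z)]
    simp only [R]; ring
  have hX0 : Xx ℓ 0 = 1 := by simp [Xx]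
  have hXd : HasDerivAt (Xx ℓ) (2 * Real.pi * Complex.I / ℓ) 0 := by
    have h1 : HasDerivAt (fun z : ℂ => 2 * Real.pi * Complex.I * z / ℓ)
        (2 * Real.pi * Complex.I / ℓ) 0 := by
      simpa using ((hasDerivAt_id (0 : ℂ)).const_mul (2 * Real.pi * Complex.I)).div_const (ℓ : ℂ)
    have h2 := h1.cexp
    rw [mul_zero, zero_div, Complex.exp_zero, one_mul] at h2
    exact h2
  have hd := ((hXd.const_sub 1).mul (hR 0).hasDerivAt)
  have hd' : deriv (vv ℓ) 0 = -(2 * Real.pi * Complex.I / ℓ) * R 0 := by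
    rw [e]
    have := hd.deriv
    rw [hX0, sub_self, zero_mul, add_zero] at this
    exact this
  rw [hd']
  have hAQ : Aq (Qq ℓ) (Qq ℓ) ≠ 0 := by
    refine Aq_ne (norm_Qq hℓ) fun n hn => ?_
    have := congrArg norm hn
    rw [← pow_succ, norm_pow, norm_one] at this
    exact (pow_lt_one₀ (norm_nonneg _) (norm_Qq hℓ) (Nat.succ_ne_zero n)).ne this
  have hR0 : R 0 = Aq (Qq ℓ) (Qq ℓ) * Aq (Qq ℓ) (Qq ℓ) := by simp [R, hX0]
  rw [hR0]
  refine mul_ne_zero (neg_ne_zero.2 (div_ne_zero Complex.two_pi_I_ne_zero hl)) (mul_ne_zero hAQ hAQ)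

lemma Qpow_Xx {ℓ : ℝ} (hℓ : 0 < ℓ) (n : ℕ) (z : ℂ) (h : Qq ℓ ^ n * Xx ℓ z = 1) : z ∈ Lam ℓ := by
  have hl : (ℓ : ℂ) ≠ 0 := by exact_mod_cast hℓ.ne'
  rw [Qq, Xx, ← Complex.exp_nat_mul, ← Complex.exp_add, Complex.exp_eq_one_iff] at h
  obtain ⟨m, hm⟩ := h
  refine ⟨m, -n, ?_⟩
  have hp := Complex.two_pi_I_ne_zero
  have : 2 * Real.pi * Complex.I * (z - (m * ℓ - n * (2 * Real.pi * Complex.I))) = 0 := by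
    unfold tau at hm
    field_simp at hm
    linear_combination (2 * Real.pi * Complex.I) * hm
  have := (mul_eq_zero.1 this).resolve_left hp
  push_cast
  linear_combination this

lemma vv_zero_at_zero {ℓ : ℝ} (hℓ : 0 < ℓ) : vv ℓ 0 = 0 := by
  have := vv_odd hℓ 0
  rw [neg_zero] at this
  exact self_eq_neg.1 this

lemma vv_thetaLike {ℓ : ℝ} (hℓ : 0 < ℓ) : ThetaLike ℓ (vv ℓ) := by
  have hq := quasi_of_gen (ℓ := ℓ) (t := vv ℓ)
    ⟨-1, 0, by norm_num, fun z => by rw [vv_one hℓ]; simp⟩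
    ⟨- Complex.exp (-(Real.pi * Complex.I * tau ℓ)), -(2 * Real.pi * Complex.I / ℓ),
      neg_ne_zero.2 (Complex.exp_ne_zero _), fun z => by
        rw [vv_two hℓ, sub_eq_add_neg, Complex.exp_add]
        have : -(2 * Real.pi * Complex.I / ℓ) * z = -(2 * Real.pi * Complex.I * z / ℓ) := by ring
        rw [this]; ring⟩
  refine ⟨vv_diff hℓ, vv_odd hℓ, hq, fun z => ⟨fun h => ?_, fun h => ?_⟩, vv_deriv0 hℓ⟩
  · by_contra hz
    refine mul_ne_zero (Complex.exp_ne_zero _) (mul_ne_zero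
      (Aq_ne (norm_Qq hℓ) fun n hn => ?_) (Aq_ne (norm_Qq hℓ) fun n hn => ?_)) h
    · exact hz (Qpow_Xx hℓ n z hn)
    · rw [← mul_assoc, ← pow_succ] at hn
      exact hz (by simpa using Lam_neg (Qpow_Xx hℓ _ _ hn))
  · obtain ⟨α, β, _, h'⟩ := hq z h
    have := h' 0
    rwa [zero_add, vv_zero_at_zero hℓ, mul_zero] at this

end ProdSec

section ThetaSec

lemma theta3_eq (τ w : ℂ) : theta3 τ w = jacobiTheta₂ w τ := by
  unfold theta3 jacobiTheta₂ jacobiTheta₂_term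
  refine tsum_congr fun n => ?_
  rw [← Complex.exp_add]; congr 1; ring

lemma theta1_eq (τ w : ℂ) : theta1 τ w = -Complex.I *
    (Complex.exp (Real.pi * Complex.I * τ / 4 + Real.pi * Complex.I * w) *
      jacobiTheta₂ (w + τ / 2 + 1 / 2) τ) := by
  unfold theta1 jacobiTheta₂ jacobiTheta₂_term
  rw [← tsum_mul_left (a := Complex.exp _)]
  congr 1
  refine tsum_congr fun n => ?_
  have e : (-1 : ℂ) ^ n = Complex.exp (n * (Real.pi * Complex.I)) := by
    rw [Complex.exp_int_mul, Complex.exp_pi_mul_I]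
  rw [e, ← Complex.exp_add, ← Complex.exp_add, ← Complex.exp_add]; congr 1; ring

lemma theta1_diff {τ : ℂ} (hτ : 0 < τ.im) : Differentiable ℂ (theta1 τ) := by
  have : theta1 τ = fun w => -Complex.I *
    (Complex.exp (Real.pi * Complex.I * τ / 4 + Real.pi * Complex.I * w) *
      jacobiTheta₂ (w + τ / 2 + 1 / 2) τ) := funext (theta1_eq τ)
  rw [this]
  have h : Differentiable ℂ (fun z => jacobiTheta₂ z τ) :=
    fun z => differentiableAt_jacobiTheta₂_fst z hτ
  have h2 : Differentiable ℂ (fun w => jacobiTheta₂ (w + τ / 2 + 1 / 2) τ) :=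
    h.comp (by fun_prop : Differentiable ℂ fun w : ℂ => w + τ / 2 + 1 / 2)
  fun_prop

lemma theta1_one (τ w : ℂ) : theta1 τ (w + 1) = - theta1 τ w := by
  rw [theta1_eq, theta1_eq]
  have e1 : w + 1 + τ / 2 + 1 / 2 = (w + τ / 2 + 1 / 2) + 1 := by ring
  have e2 : Real.pi * Complex.I * τ / 4 + Real.pi * Complex.I * (w + 1) =
    (Real.pi * Complex.I * τ / 4 + Real.pi * Complex.I * w) + Real.pi * Complex.I := by ring
  rw [e1, jacobiTheta₂_add_left, e2, Complex.exp_add _ (Real.pi * Complex.I),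
    Complex.exp_pi_mul_I]
  ring

lemma theta1_tau (τ w : ℂ) : theta1 τ (w + τ) =
    - Complex.exp (-(Real.pi * Complex.I * τ) - 2 * Real.pi * Complex.I * w) * theta1 τ w := by
  rw [theta1_eq, theta1_eq]
  have e1 : w + τ + τ / 2 + 1 / 2 = (w + τ / 2 + 1 / 2) + τ := by ring
  rw [e1, jacobiTheta₂_add_left']
  have e : Complex.exp (Real.pi * Complex.I * τ / 4 + Real.pi * Complex.I * (w + τ)) *
      Complex.exp (-Real.pi * Complex.I * (τ + 2 * (w + τ / 2 + 1 / 2))) =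
      - (Complex.exp (-(Real.pi * Complex.I * τ) - 2 * Real.pi * Complex.I * w) *
      Complex.exp (Real.pi * Complex.I * τ / 4 + Real.pi * Complex.I * w)) := by
    have hm : ∀ x : ℂ, - Complex.exp x = Complex.exp (x - Real.pi * Complex.I) := fun x => by
      rw [Complex.exp_sub, Complex.exp_pi_mul_I]; ring
    rw [← Complex.exp_add, ← Complex.exp_add, hm]
    congr 1; ring
  linear_combination -Complex.I * jacobiTheta₂ (w + τ / 2 + 1 / 2) τ * e

lemma theta1_zero (τ : ℂ) : theta1 τ 0 = 0 := by
  rw [theta1_eq]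
  have h1 := jacobiTheta₂_add_left' (-(0 + τ / 2 + 1 / 2)) τ
  have h2 := jacobiTheta₂_add_left (-(0 + τ / 2 + 1 / 2) + τ) τ
  have e : -(0 + τ / 2 + 1 / 2) + τ + 1 = 0 + τ / 2 + 1 / 2 := by ring
  have e3 : -Real.pi * Complex.I * (τ + 2 * -(0 + τ / 2 + 1 / 2)) = Real.pi * Complex.I := by ring
  rw [e, h1, e3, Complex.exp_pi_mul_I, jacobiTheta₂_neg_left, neg_one_mul] at h2
  rw [self_eq_neg.1 h2]; simp

lemma theta3_theta1 (τ w : ℂ) : theta3 τ w =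
    Complex.exp (Real.pi * Complex.I * τ / 4) * Complex.exp (Real.pi * Complex.I * w) *
      theta1 τ (w + 1 / 2 + τ / 2) := by
  rw [theta3_eq, theta1_eq]
  have e1 : w + 1 / 2 + τ / 2 + τ / 2 + 1 / 2 = w + τ + 1 := by ring
  rw [e1, jacobiTheta₂_add_left, jacobiTheta₂_add_left']
  have e : Complex.exp (Real.pi * Complex.I * τ / 4) * Complex.exp (Real.pi * Complex.I * w) *
      Complex.exp (Real.pi * Complex.I * τ / 4 + Real.pi * Complex.I * (w + 1 / 2 + τ / 2)) *
      Complex.exp (-Real.pi * Complex.I * (τ + 2 * w)) = Complex.I := by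
    rw [← Complex.exp_add, ← Complex.exp_add, ← Complex.exp_add]
    refine Eq.trans ?_ Complex.exp_pi_div_two_mul_I
    congr 1; ring
  linear_combination Complex.I * jacobiTheta₂ w τ * e + jacobiTheta₂ w τ * Complex.I_mul_I

lemma theta1_vv {ℓ : ℝ} (hℓ : 0 < ℓ) : ∃ c : ℂ, ∀ z, theta1 (tau ℓ) (z / ℓ) = c * vv ℓ z := by
  have hl : (ℓ : ℂ) ≠ 0 := by exact_mod_cast hℓ.ne'
  have T := vv_thetaLike hℓ
  have t1 : ∀ z : ℂ, theta1 (tau ℓ) ((z + ℓ) / ℓ) = - theta1 (tau ℓ) (z / ℓ) := fun z => by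
    rw [add_div, div_self hl, theta1_one]
  have t2 : ∀ z : ℂ, theta1 (tau ℓ) ((z + 2 * Real.pi * Complex.I) / ℓ) =
      - Complex.exp (-(Real.pi * Complex.I * tau ℓ) - 2 * Real.pi * Complex.I * z / ℓ) *
        theta1 (tau ℓ) (z / ℓ) := fun z => by
    have : (z + 2 * Real.pi * Complex.I) / ℓ = z / ℓ + tau ℓ := by unfold tau; ring
    rw [this, theta1_tau, mul_div_assoc (2 * Real.pi * Complex.I) z]
  have hq := quasi_of_gen (ℓ := ℓ) (t := fun z => theta1 (tau ℓ) (z / ℓ))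
    ⟨-1, 0, by norm_num, fun z => by rw [t1]; simp⟩
    ⟨- Complex.exp (-(Real.pi * Complex.I * tau ℓ)), -(2 * Real.pi * Complex.I / ℓ),
      neg_ne_zero.2 (Complex.exp_ne_zero _), fun z => by
        rw [t2, sub_eq_add_neg, Complex.exp_add]
        have : -(2 * Real.pi * Complex.I / ℓ) * z = -(2 * Real.pi * Complex.I * z / ℓ) := by ring
        rw [this]; ring⟩
  refine eq_const_mul hℓ (u := fun z => theta1 (tau ℓ) (z / ℓ)) (v := vv ℓ)
    ((theta1_diff (tau_im hℓ)).comp (by fun_prop : Differentiable ℂ fun z : ℂ => z / ℓ))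
    T.diff ?_ ?_
  · intro x hx
    have hx' := (T.zero x).1 hx
    refine ⟨?_, T.deriv_ne hx'⟩
    obtain ⟨α, β, _, h⟩ := hq x hx'
    have := h 0
    simp only [zero_add, zero_div, theta1_zero, mul_zero] at this
    exact this
  · rintro ω (rfl | rfl)
    · exact ⟨fun _ => -1, fun x => ⟨by norm_num, by simpa using t1 x, by simpa using vv_one hℓ x⟩⟩
    · exact ⟨fun x => - Complex.exp (-(Real.pi * Complex.I * tau ℓ) -
        2 * Real.pi * Complex.I * x / ℓ), fun x => ⟨neg_ne_zero.2 (Complex.exp_ne_zero _),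
          t2 x, vv_two hℓ x⟩⟩

lemma fmu_eq {ℓ μ : ℝ} (hℓ : 0 < ℓ) (hμ : theta3 (tau ℓ) (μ : ℂ) ≠ 0) :
    ((μ + 1 / 2) * ℓ + Real.pi * Complex.I : ℂ) ∉ Lam ℓ ∧ ∀ z, z ∉ Lam ℓ → fmu ℓ μ z =
      (-2 * Complex.I / (Real.pi : ℂ)) * Complex.exp (Real.pi * Complex.I / ℓ * z) *
        ThetaLike.F (vv ℓ) ((μ + 1 / 2) * ℓ + Real.pi * Complex.I) z := by
  have hl : (ℓ : ℂ) ≠ 0 := by exact_mod_cast hℓ.ne'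
  have hp : (Real.pi : ℂ) ≠ 0 := by exact_mod_cast Real.pi_ne_zero
  have T := vv_thetaLike hℓ
  obtain ⟨c, hc⟩ := theta1_vv hℓ
  have h3 : ∀ z : ℂ, theta3 (tau ℓ) (z / ℓ + μ) =
      Complex.exp (Real.pi * Complex.I * tau ℓ / 4) *
      Complex.exp (Real.pi * Complex.I * (z / ℓ + μ)) *
        (c * vv ℓ (z + ((μ + 1 / 2) * ℓ + Real.pi * Complex.I))) := fun z => by
    rw [theta3_theta1, ← hc]
    congr 2
    unfold tau
    field_simp
    ring
  have h30 := h3 0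
  rw [zero_div, zero_add, zero_add] at h30
  rw [h30] at hμ
  have hcv : c * vv ℓ ((μ + 1 / 2) * ℓ + Real.pi * Complex.I) ≠ 0 := right_ne_zero_of_mul hμ
  have hc0 := left_ne_zero_of_mul hcv
  have hv0 := right_ne_zero_of_mul hcv
  refine ⟨fun h => hv0 ((T.zero _).2 h), fun z hz => ?_⟩
  have hvz : vv ℓ z ≠ 0 := mt (T.zero _).1 hz
  have hd : deriv (theta1 (tau ℓ)) 0 = c * (deriv (vv ℓ) 0 * ℓ) := by
    have e : theta1 (tau ℓ) = fun w => c * vv ℓ (w * ℓ) := by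
      funext w; rw [← hc, mul_div_cancel_right₀ _ hl]
    have h1 : HasDerivAt (fun w : ℂ => w * (ℓ : ℂ)) (ℓ : ℂ) 0 := by
      simpa using (hasDerivAt_id (0 : ℂ)).mul_const (ℓ : ℂ)
    have h2 : HasDerivAt (vv ℓ) (deriv (vv ℓ) 0) ((fun w : ℂ => w * (ℓ : ℂ)) 0) := by
      simpa using T.hda 0
    rw [e]
    exact ((h2.comp 0 h1).const_mul c).deriv
  unfold fmu gmu ThetaLike.F
  rw [hd, h3, h30, hc]
  have e : Complex.exp (Real.pi * Complex.I * (z / ℓ + μ)) =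
      Complex.exp (Real.pi * Complex.I / ℓ * z) * Complex.exp (Real.pi * Complex.I * μ) := by
    rw [← Complex.exp_add]; congr 1; ring
  rw [e]
  have hE1 := Complex.exp_ne_zero (Real.pi * Complex.I * tau ℓ / 4)
  have hE2 := Complex.exp_ne_zero (Real.pi * Complex.I * μ)
  have hI : (2 : ℂ) / (Real.pi * Complex.I) = -2 * Complex.I / Real.pi := by
    field_simp
    linear_combination Complex.I_mul_I
  rw [hI]
  generalize Complex.exp (Real.pi * Complex.I * tau ℓ / 4) = E1 at *
  generalize Complex.exp (Real.pi * Complex.I * μ) = E2 at *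
  generalize Complex.exp (Real.pi * Complex.I / ℓ * z) = E3 at *
  generalize vv ℓ (z + ((μ + 1 / 2) * ℓ + Real.pi * Complex.I)) = V1 at *
  generalize vv ℓ ((μ + 1 / 2) * ℓ + Real.pi * Complex.I) = V2 at *
  generalize vv ℓ z = V3 at *
  field_simp

end ThetaSec
/-- computation in Corollary 3.13: the `n`-cycle sum of `f_μ` equals
`(−2i/π)ⁿ ℘^{(n−2)}(z_μ;Λ_ℓ)`. -/
theorem stmt9 (ℓ μ : ℝ) (hℓ : 0 < ℓ)
    (hμ : theta3 (tau ℓ) (μ : ℂ) ≠ 0)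
    (n : ℕ) (hn : 3 ≤ n) (z : Fin n → ℂ)
    (hz : ∀ j k : Fin n, j ≠ k → z j - z k ∉ lat (ℓ : ℂ) (2 * Real.pi * Complex.I)) :
    cycleSum n (fmu ℓ μ) z =
      (-2 * Complex.I / (Real.pi : ℂ)) ^ n *
        iteratedDeriv (n - 2) (wp (ℓ : ℂ) (2 * Real.pi * Complex.I)) (zmu ℓ μ) := by
  obtain ⟨k, rfl⟩ : ∃ k, n = k + 3 := ⟨n - 3, by omega⟩
  have T := vv_thetaLike hℓ
  obtain ⟨ha, hf⟩ := fmu_eq hℓ hμ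
  rw [cycleSum_congr (by omega) (fmu ℓ μ)
    (ThetaLike.F (vv ℓ) ((μ + 1 / 2) * ℓ + Real.pi * Complex.I)) z _ _
    (fun i j hij => hf _ (hz i j hij)), ThetaLike.cycleSum_main hℓ T k z hz _ ha, wp_eq hℓ]
  congr 1
  have e2 : k + 3 - 2 = k + 1 := by omega
  rw [e2]
  have hz' : zmu ℓ μ = -((μ + 1 / 2) * ℓ + Real.pi * Complex.I) +
      (ℓ + 2 * Real.pi * Complex.I) := by
    unfold zmu; ring
  have hl : (ℓ + 2 * Real.pi * Complex.I : ℂ) ∈ (PP ℓ hℓ).lattice :=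
    (mem_PP hℓ _).2 (Lam_add (Lam_one ℓ) (Lam_two ℓ))
  have hper : (fun x => (PP ℓ hℓ).weierstrassP (x + (ℓ + 2 * Real.pi * Complex.I))) =
      (PP ℓ hℓ).weierstrassP := funext fun x => (PP ℓ hℓ).weierstrassP_add_coe x ⟨_, hl⟩
  have hneg : (fun x => (PP ℓ hℓ).weierstrassP (-x)) = (PP ℓ hℓ).weierstrassP :=
    funext fun x => (PP ℓ hℓ).weierstrassP_neg x
  have h1 := iteratedDeriv_comp_add_const (k + 1) (PP ℓ hℓ).weierstrassP
    (ℓ + 2 * Real.pi * Complex.I)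
  rw [hper] at h1
  have h2 := iteratedDeriv_comp_neg (k + 1) (PP ℓ hℓ).weierstrassP
    ((μ + 1 / 2) * ℓ + Real.pi * Complex.I)
  rw [hneg] at h2
  rw [hz', ← congrFun h1, h2, smul_eq_mul, ← mul_assoc, ← pow_add,
    show k + 3 + (k + 1) = 2 * (k + 2) by ring, pow_mul]
  simp
end

section
/- Let ℓ > 0 and μ ∈ ℝ. Set p_k := exp(−ℓ(k−μ)²/2) for k ∈ ℤ, Z := ∑_{k∈ℤ} p_k, and a := Z⁻¹·∑_{k∈ℤ} k·p_k. Define the cumulant generating function K(t) := log(Z⁻¹·∑_{k∈ℤ} p_k·e^{t(k−a)}) for t ∈ ℝ (the series converges for all real t and K is smooth near 0). Then for every integer n ≥ 3, the n-th derivative of K at t = 0 equals (−1)^{n−1}·℘^{(n−2)}(z_μ; Λ_ℓ), where z_μ := (1/2 − μ)·ℓ + πi. -/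
open Complex

namespace DiscGauss

/-- Entire functions with the quasi-periodicity of the square of a theta function. -/
structure IsV (ℓ : ℝ) (f : ℂ → ℂ) : Prop where
  diff : Differentiable ℂ f
  per : ∀ x, f (x + 2 * Real.pi * Complex.I) = f x
  quasi : ∀ x, f (x + ℓ) = Complex.exp (2 * x + ℓ) * f x

lemma IsV.comb {ℓ : ℝ} {f g : ℂ → ℂ} (hf : IsV ℓ f) (hg : IsV ℓ g) (a b : ℂ) :
    IsV ℓ (fun x => a * f x + b * g x) where
  diff := (hf.diff.const_mul a).add (hg.diff.const_mul b)
  per x := by simp only [hf.per, hg.per]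
  quasi x := by simp only [hf.quasi, hg.quasi]; ring

/-- Fourier coefficient along the imaginary axis. -/
noncomputable def fc (f : ℂ → ℂ) (k : ℤ) : ℂ :=
  ∫ y : ℝ in (0:ℝ)..(2 * Real.pi), f (y * Complex.I) * Complex.exp (-(k * (y * Complex.I)))

lemma fc_comb {f g : ℂ → ℂ} (hf : Differentiable ℂ f) (hg : Differentiable ℂ g) (a b : ℂ)
    (k : ℤ) : fc (fun x => a * f x + b * g x) k = a * fc f k + b * fc g k := by
  have hf' := hf.continuous
  have hg' := hg.continuous
  unfold fc
  rw [← intervalIntegral.integral_const_mul, ← intervalIntegral.integral_const_mul,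
    ← intervalIntegral.integral_add]
  · congr 1; ext y; ring
  · apply Continuous.intervalIntegrable; fun_prop
  · apply Continuous.intervalIntegrable; fun_prop

lemma exp_neg_int_two_pi (k : ℤ) :
    Complex.exp (-(k * (2 * Real.pi * Complex.I))) = 1 := by
  rw [Complex.exp_neg, Complex.exp_int_mul_two_pi_mul_I, inv_one]

lemma fc_rec {ℓ : ℝ} {f : ℂ → ℂ} (hf : IsV ℓ f) (k : ℤ) :
    fc f k = Complex.exp (ℓ - k * ℓ) * fc f (k - 2) := by
  have hd := hf.diff
  have key := Complex.integral_boundary_rect_eq_zero_of_differentiableOn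
    (fun z => f z * Complex.exp (-(k * z))) 0 (ℓ + (2 * Real.pi : ℝ) * Complex.I)
    (by fun_prop)
  have hper : ∀ x : ℂ, f (x + 2 * Real.pi * Complex.I) *
      Complex.exp (-(k * (x + 2 * Real.pi * Complex.I))) = f x * Complex.exp (-(k * x)) := by
    intro x
    rw [hf.per, mul_add, neg_add, Complex.exp_add, exp_neg_int_two_pi, mul_one]
  simp at key
  simp only [hper, sub_self, zero_add] at key
  have key2 := mul_left_cancel₀ Complex.I_ne_zero (sub_eq_zero.mp key)
  unfold fc
  rw [← key2, ← intervalIntegral.integral_const_mul]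
  congr 1; ext y
  rw [add_comm (ℓ : ℂ), hf.quasi]
  rw [mul_comm (Complex.exp _) (f _), mul_assoc, ← Complex.exp_add,
    mul_left_comm (Complex.exp (ℓ - k * ℓ)), ← Complex.exp_add (ℓ - k * ℓ)]
  congr 2
  push_cast; ring

lemma fc_all_zero {ℓ : ℝ} {f : ℂ → ℂ} (hf : IsV ℓ f) (h0 : fc f 0 = 0) (h1 : fc f 1 = 0) (k : ℤ) :
    fc f k = 0 := by
  have up : ∀ k : ℤ, fc f k = 0 → fc f (k + 2) = 0 := by
    intro k hk
    rw [fc_rec hf]; simp [hk]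
  have dn : ∀ k : ℤ, fc f k = 0 → fc f (k - 2) = 0 := by
    intro k hk
    rw [fc_rec hf] at hk
    simpa using hk
  have : ∀ k : ℤ, fc f k = 0 ∧ fc f (k + 1) = 0 := by
    intro k
    induction k using Int.induction_on with
    | zero => simpa using ⟨h0, h1⟩
    | succ n ih => exact ⟨ih.2, by have := up _ ih.1; rwa [add_assoc]⟩
    | pred n ih =>
      refine ⟨?_, by simpa using ih.1⟩
      have := dn _ ih.2
      convert this using 2; ring
  exact (this k).1

lemma IsV.eq_zero {ℓ : ℝ} {f : ℂ → ℂ} (hf : IsV ℓ f) (h0 : fc f 0 = 0) (h1 : fc f 1 = 0) (x : ℂ) :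
    f x = 0 := by
  have hT : Fact (0 < 2 * Real.pi) := ⟨by positivity⟩
  have hcont := hf.diff.continuous
  have hp : Function.Periodic (fun y : ℝ => f (y * Complex.I)) (2 * Real.pi) := by
    intro y
    simp only
    rw [← hf.per (y * Complex.I)]; congr 1; push_cast; ring
  let g : C(AddCircle (2 * Real.pi), ℂ) :=
    ⟨hp.lift, continuous_coinduced_dom.mpr (by
      change Continuous (fun y : ℝ => f (y * Complex.I)); fun_prop)⟩
  have hg : ∀ y : ℝ, g (y : AddCircle (2 * Real.pi)) = f (y * Complex.I) := fun y => rfl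
  have hc : fourierCoeff g = 0 := by
    ext k
    rw [fourierCoeff_eq_intervalIntegral _ _ 0]
    have : (∫ y : ℝ in (0:ℝ)..(0 + 2 * Real.pi), (fourier (-k)) (y : AddCircle (2 * Real.pi)) •
        g (y : AddCircle (2 * Real.pi))) = fc f k := by
      unfold fc
      rw [zero_add]
      congr 1; ext y
      rw [fourier_coe_apply, hg, smul_eq_mul, mul_comm]
      congr 2
      have : (Real.pi : ℂ) ≠ 0 := by exact_mod_cast Real.pi_ne_zero
      push_cast; field_simp
    rw [this, fc_all_zero hf h0 h1]; simp
  have hz : ∀ y : ℝ, f (y * Complex.I) = 0 := by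
    intro y
    have := has_pointwise_sum_fourier_series_of_summable (f := g) (by rw [hc]; exact summable_zero) y
    rw [hc] at this
    simp only [Pi.zero_apply, zero_smul] at this
    rw [← hg]; exact this.unique hasSum_zero
  have hana : AnalyticOnNhd ℂ f Set.univ := hf.diff.differentiableOn.analyticOnNhd isOpen_univ
  have : f = fun _ => 0 := by
    refine hana.eq_of_frequently_eq (z₀ := 0) analyticOnNhd_const ?_
    have ht : Filter.Tendsto (fun y : ℝ => (y : ℂ) * Complex.I) (nhdsWithin 0 {0}ᶜ)
        (nhdsWithin 0 {0}ᶜ) := by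
      apply tendsto_nhdsWithin_iff.mpr ⟨?_, ?_⟩
      · have : Continuous (fun y : ℝ => (y : ℂ) * Complex.I) := by fun_prop
        have h2 := this.tendsto 0
        simp at h2
        exact h2.mono_left nhdsWithin_le_nhds
      · filter_upwards [self_mem_nhdsWithin] with y hy
        simpa using hy
    exact ht.frequently (Filter.Frequently.of_forall hz)
  rw [this]

/-- The space has dimension at most two: linear dependence on the kernel of evaluation at `0`. -/
lemma IsV.dep {ℓ : ℝ} {φ D T : ℂ → ℂ} (hφ : IsV ℓ φ) (hD : IsV ℓ D) (hT : IsV ℓ T)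
    (hφ0 : φ 0 ≠ 0) (hD0 : D 0 = 0) (hT0 : T 0 = 0) (u : ℂ) (hu : T u ≠ 0) :
    ∃ c : ℂ, ∀ x, D x = c * T x := by
  have hdet : fc D 0 * fc T 1 - fc D 1 * fc T 0 = 0 := by
    by_contra hne
    apply hφ0
    have h1 := (hD.comb hT (fc φ 0 * fc T 1 - fc φ 1 * fc T 0) (fc D 0 * fc φ 1 - fc D 1 * fc φ 0))
    have h2 := hφ.comb h1 (fc D 0 * fc T 1 - fc D 1 * fc T 0) (-1)
    have h3 := h2.eq_zero
      (by rw [fc_comb hφ.diff h1.diff, fc_comb hD.diff hT.diff]; ring)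
      (by rw [fc_comb hφ.diff h1.diff, fc_comb hD.diff hT.diff]; ring) 0
    simp only [hD0, hT0, mul_zero, add_zero] at h3
    exact (mul_eq_zero.mp h3).resolve_left hne
  by_cases t0 : fc T 0 = 0
  · have t1 : fc T 1 ≠ 0 := fun t1 => hu (hT.eq_zero t0 t1 u)
    refine ⟨fc D 1 / fc T 1, fun x => ?_⟩
    have h := (hD.comb hT (fc T 1) (-fc D 1)).eq_zero
      (by rw [fc_comb hD.diff hT.diff]; linear_combination hdet)
      (by rw [fc_comb hD.diff hT.diff]; ring) x
    field_simp
    linear_combination h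
  · refine ⟨fc D 0 / fc T 0, fun x => ?_⟩
    have h := (hD.comb hT (fc T 0) (-fc D 0)).eq_zero
      (by rw [fc_comb hD.diff hT.diff]; ring)
      (by rw [fc_comb hD.diff hT.diff]; linear_combination -hdet) x
    field_simp
    linear_combination h

/-- The entire function `∑ exp(-ℓ k²/2 + s k)`. -/
noncomputable def FF (ℓ : ℝ) (s : ℂ) : ℂ :=
  jacobiTheta₂ (s / (2 * Real.pi * Complex.I)) (ℓ / (2 * Real.pi) * Complex.I)

lemma tau_im {ℓ : ℝ} (hℓ : 0 < ℓ) : 0 < ((ℓ : ℂ) / (2 * Real.pi) * Complex.I).im := by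
  have : ((ℓ : ℂ) / (2 * Real.pi) * Complex.I) = ((ℓ / (2 * Real.pi) : ℝ) : ℂ) * Complex.I := by
    push_cast; ring
  rw [this, Complex.im_ofReal_mul, Complex.I_im]
  positivity

lemma pi_ne : (Real.pi : ℂ) ≠ 0 := by exact_mod_cast Real.pi_ne_zero

lemma term_eq (ℓ : ℝ) (s : ℂ) (k : ℤ) :
    jacobiTheta₂_term k (s / (2 * Real.pi * Complex.I)) (ℓ / (2 * Real.pi) * Complex.I) =
      Complex.exp (-ℓ * k ^ 2 / 2 + s * k) := by
  unfold jacobiTheta₂_term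
  congr 1
  have := pi_ne
  field_simp
  linear_combination (k:ℂ)^2 * ℓ * Complex.I_sq

lemma FF_hasSum {ℓ : ℝ} (hℓ : 0 < ℓ) (s : ℂ) :
    HasSum (fun k : ℤ => Complex.exp (-ℓ * k ^ 2 / 2 + s * k)) (FF ℓ s) := by
  have := hasSum_jacobiTheta₂_term (s / (2 * Real.pi * Complex.I)) (tau_im hℓ)
  simp only [term_eq] at this
  exact this

lemma FF_diff {ℓ : ℝ} (hℓ : 0 < ℓ) : Differentiable ℂ (FF ℓ) := by
  intro s
  have := differentiableAt_jacobiTheta₂_fst (s / (2 * Real.pi * Complex.I)) (tau_im hℓ)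
  exact DifferentiableAt.comp (f := fun s : ℂ => s / (2 * Real.pi * Complex.I)) s this
    (by fun_prop)

lemma FF_neg (ℓ : ℝ) (s : ℂ) : FF ℓ (-s) = FF ℓ s := by
  unfold FF
  rw [neg_div, jacobiTheta₂_neg_left]

lemma FF_per (ℓ : ℝ) (s : ℂ) : FF ℓ (s + 2 * Real.pi * Complex.I) = FF ℓ s := by
  unfold FF
  rw [← jacobiTheta₂_add_left (s / _)]
  congr 1
  have := pi_ne
  field_simp

lemma FF_quasi (ℓ : ℝ) (s : ℂ) : FF ℓ (s + ℓ) = Complex.exp (s + ℓ / 2) * FF ℓ s := by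
  have h := jacobiTheta₂_add_left' ((s + ℓ) / (2 * Real.pi * Complex.I))
    (ℓ / (2 * Real.pi) * Complex.I)
  have hp := pi_ne
  have e1 : (s + ℓ) / (2 * Real.pi * Complex.I) + ℓ / (2 * Real.pi) * Complex.I
      = s / (2 * Real.pi * Complex.I) := by
    field_simp
    linear_combination (ℓ : ℂ) * Complex.I_sq
  have e2 : -(Real.pi : ℂ) * Complex.I * (ℓ / (2 * Real.pi) * Complex.I +
      2 * ((s + ℓ) / (2 * Real.pi * Complex.I))) = -(s + ℓ / 2) := by
    field_simp
    linear_combination -(ℓ : ℂ) * Complex.I_sq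
  rw [e1, e2] at h
  unfold FF
  rw [h, ← mul_assoc, ← Complex.exp_add, add_neg_cancel, Complex.exp_zero, one_mul]

/-- The odd theta function. -/
noncomputable def th (ℓ : ℝ) (x : ℂ) : ℂ :=
  Complex.exp (-1 / 2 * x) * FF ℓ (x + (ℓ / 2 + Real.pi * Complex.I))

lemma th_diff {ℓ : ℝ} (hℓ : 0 < ℓ) : Differentiable ℂ (th ℓ) := by
  have := FF_diff hℓ
  unfold th
  fun_prop

lemma th_per (ℓ : ℝ) (x : ℂ) : th ℓ (x + 2 * Real.pi * Complex.I) = - th ℓ x := by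
  unfold th
  rw [add_right_comm, FF_per, mul_add, Complex.exp_add,
    show (-1 / 2 * (2 * Real.pi * Complex.I) : ℂ) = -(Real.pi * Complex.I) by ring,
    Complex.exp_neg, Complex.exp_pi_mul_I]
  norm_num

lemma th_quasi (ℓ : ℝ) (x : ℂ) : th ℓ (x + ℓ) = - (Complex.exp (x + ℓ / 2) * th ℓ x) := by
  unfold th
  rw [add_right_comm, FF_quasi, ← mul_assoc, ← mul_assoc, ← neg_mul, ← Complex.exp_add,
    ← Complex.exp_add]
  rw [show (-1 / 2 * (x + ℓ) + (x + (ℓ / 2 + Real.pi * Complex.I) + ℓ / 2) : ℂ)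
    = (x + ℓ / 2 + -1 / 2 * x) + Real.pi * Complex.I by ring, Complex.exp_add _ (Real.pi * Complex.I),
    Complex.exp_pi_mul_I]
  ring

lemma th_odd (ℓ : ℝ) (x : ℂ) : th ℓ (-x) = - th ℓ x := by
  have e : FF ℓ (x + (ℓ / 2 + Real.pi * Complex.I)) =
      Complex.exp (x - Real.pi * Complex.I) * FF ℓ (-x + (ℓ / 2 + Real.pi * Complex.I)) := by
    rw [← FF_neg ℓ (-x + (ℓ / 2 + Real.pi * Complex.I)),
      show x + (ℓ / 2 + Real.pi * Complex.I) = -(-x + (ℓ / 2 + Real.pi * Complex.I)) + ℓ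
        + 2 * Real.pi * Complex.I by ring, FF_per, FF_quasi]
    congr 2
    ring
  unfold th
  rw [e, ← mul_assoc, ← Complex.exp_add,
    show (-1 / 2 * x + (x - Real.pi * Complex.I) : ℂ) = -1 / 2 * (-x) + -(Real.pi * Complex.I) by ring,
    Complex.exp_add, Complex.exp_neg, Complex.exp_pi_mul_I]
  norm_num

lemma th_zero (ℓ : ℝ) : th ℓ 0 = 0 := by
  have := th_odd ℓ 0
  rw [neg_zero] at this
  exact CharZero.eq_neg_self_iff.mp this

/-- `f f'' - f'^2`. -/
noncomputable def EE (f : ℂ → ℂ) (x : ℂ) : ℂ := f x * deriv (deriv f) x - (deriv f x) ^ 2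

lemma EE_exp {f : ℂ → ℂ} (hf : Differentiable ℂ f) (C a d : ℂ) (x : ℂ) :
    EE (fun x => C * Complex.exp (a * x) * f (x + d)) x =
      (C * Complex.exp (a * x)) ^ 2 * EE f (x + d) := by
  have hf' : Differentiable ℂ (deriv f) := hf.deriv
  have he : ∀ x, HasDerivAt (fun x : ℂ => C * Complex.exp (a * x)) (C * (Complex.exp (a * x) * a)) x := by
    intro x
    have := ((hasDerivAt_id x).const_mul a).cexp.const_mul C
    simpa using this
  have hF : ∀ x, HasDerivAt (fun x => f (x + d)) (deriv f (x + d)) x := fun x =>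
    (hf (x + d)).hasDerivAt.comp_add_const x d
  have hF' : ∀ x, HasDerivAt (fun x => deriv f (x + d)) (deriv (deriv f) (x + d)) x := fun x =>
    (hf' (x + d)).hasDerivAt.comp_add_const x d
  have h1 : deriv (fun x => C * Complex.exp (a * x) * f (x + d)) =
      fun x => a * (C * Complex.exp (a * x) * f (x + d)) +
        C * Complex.exp (a * x) * deriv f (x + d) := by
    ext x
    refine ((he x).mul (hF x)).deriv.trans ?_
    ring
  have h2 : deriv (deriv (fun x => C * Complex.exp (a * x) * f (x + d))) x =
      a * (C * (Complex.exp (a * x) * a) * f (x + d) + C * Complex.exp (a * x) * deriv f (x + d)) +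
      (C * (Complex.exp (a * x) * a) * deriv f (x + d) +
        C * Complex.exp (a * x) * deriv (deriv f) (x + d)) := by
    rw [h1]
    exact ((((he x).mul (hF x)).const_mul a).add ((he x).mul (hF' x))).deriv
  unfold EE
  rw [h2, h1]
  ring

lemma EE_diff {f : ℂ → ℂ} (hf : Differentiable ℂ f) : Differentiable ℂ (EE f) := by
  have h1 : Differentiable ℂ (deriv f) := hf.deriv
  have h2 : Differentiable ℂ (deriv (deriv f)) := h1.deriv
  unfold EE
  fun_prop

lemma EE_shift {f : ℂ → ℂ} (hf : Differentiable ℂ f) (d x : ℂ) :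
    EE (fun x => f (x + d)) x = EE f (x + d) := by
  have := EE_exp hf 1 0 d x
  simpa using this

lemma EE_th_per {ℓ : ℝ} (hℓ : 0 < ℓ) (x : ℂ) :
    EE (th ℓ) (x + 2 * Real.pi * Complex.I) = EE (th ℓ) x := by
  rw [← EE_shift (th_diff hℓ)]
  have := EE_exp (th_diff hℓ) (-1) 0 0 x
  simp only [zero_mul, Complex.exp_zero, add_zero] at this
  simp only [th_per]
  simpa using this

lemma EE_th_quasi {ℓ : ℝ} (hℓ : 0 < ℓ) (x : ℂ) :
    EE (th ℓ) (x + ℓ) = Complex.exp (2 * x + ℓ) * EE (th ℓ) x := by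
  rw [← EE_shift (th_diff hℓ)]
  have := EE_exp (th_diff hℓ) (-Complex.exp (ℓ / 2)) 1 0 x
  simp only [one_mul, add_zero] at this
  simp only [th_quasi]
  have e : (fun x => -(Complex.exp (x + ℓ / 2) * th ℓ x)) =
    (fun x => -Complex.exp (ℓ / 2) * Complex.exp x * th ℓ x) := by
    ext x; rw [Complex.exp_add]; ring
  rw [e, this]
  congr 1
  rw [mul_pow, neg_sq, ← Complex.exp_nat_mul, ← Complex.exp_nat_mul, ← Complex.exp_add]
  congr 1
  push_cast; ring

lemma EE_th_eq {ℓ : ℝ} (hℓ : 0 < ℓ) (x : ℂ) :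
    EE (th ℓ) x = Complex.exp (-1 / 2 * x) ^ 2 * EE (FF ℓ) (x + (ℓ / 2 + Real.pi * Complex.I)) := by
  have := EE_exp (FF_diff hℓ) 1 (-1 / 2) (ℓ / 2 + Real.pi * Complex.I) x
  simp only [one_mul] at this
  exact this

/-- The period pair `(ℓ, 2πi)`. -/
noncomputable def LL (ℓ : ℝ) (hℓ : 0 < ℓ) : PeriodPair where
  ω₁ := ℓ
  ω₂ := 2 * Real.pi * Complex.I
  indep := by
    rw [LinearIndependent.pair_iff]
    intro s t h
    have h1 := congrArg Complex.re h
    have h2 := congrArg Complex.im h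
    simp at h1 h2
    exact ⟨h1.resolve_right hℓ.ne', h2⟩

lemma wp_eq (ℓ : ℝ) (hℓ : 0 < ℓ) (z : ℂ) :
    wp (ℓ : ℂ) (2 * Real.pi * Complex.I) z = (LL ℓ hℓ).weierstrassP z := by
  rw [← (LL ℓ hℓ).weierstrassPExcept_add 0 z]
  unfold wp PeriodPair.weierstrassPExcept
  rw [← (LL ℓ hℓ).latticeEquivProd.symm.toEquiv.tsum_eq]
  rw [add_comm]
  congr 1
  · have := tsum_subtype {p : ℤ × ℤ | p ≠ 0}
      (fun p => (1 / (z - ((p.1 : ℂ) * ℓ + (p.2 : ℂ) * (2 * Real.pi * Complex.I))) ^ 2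
      - 1 / ((p.1 : ℂ) * ℓ + (p.2 : ℂ) * (2 * Real.pi * Complex.I)) ^ 2))
    refine this.trans (tsum_congr fun p => ?_)
    have hc : ((LL ℓ hℓ).latticeEquivProd.symm p).1 = p.1 * (ℓ : ℂ) + p.2 * (2 * Real.pi * Complex.I) :=
      (LL ℓ hℓ).latticeEquiv_symm_apply p
    by_cases hp : p = 0
    · subst hp; simp
    · rw [Set.indicator_of_mem (by exact hp)]
      simp only [LinearEquiv.coe_toEquiv]
      rw [if_neg, hc]
      simpa using hp
  · simp

lemma th_lattice_zero {ℓ : ℝ} (hℓ : 0 < ℓ) {l : ℂ} (hl : l ∈ (LL ℓ hℓ).lattice) : th ℓ l = 0 := by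
  obtain ⟨m, n, h⟩ := PeriodPair.mem_lattice.mp hl
  have p1 : Function.Periodic (fun x => th ℓ x = 0) (ℓ : ℂ) := by
    intro x; simp [th_quasi]
  have p2 : Function.Periodic (fun x => th ℓ x = 0) (2 * Real.pi * Complex.I : ℂ) := by
    intro x; simp [th_per]
  have e1 := p1.int_mul m 0
  have e2 := p2.int_mul n (0 + m * ℓ)
  have h' : 0 + m * (ℓ : ℂ) + n * (2 * Real.pi * Complex.I) = l := by rw [zero_add]; exact h
  rw [h'] at e2
  simp only [th_zero, eq_iff_iff, iff_true] at e1
  exact e2.mpr e1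

open scoped Classical in
/-- The entire function `θθ'' - θ'² + ℘θ²`. -/
noncomputable def DD (ℓ : ℝ) (hℓ : 0 < ℓ) (x : ℂ) : ℂ :=
  if x ∈ (LL ℓ hℓ).lattice then 0 else EE (th ℓ) x + (LL ℓ hℓ).weierstrassP x * th ℓ x ^ 2

lemma DD_diff (ℓ : ℝ) (hℓ : 0 < ℓ) : Differentiable ℂ (DD ℓ hℓ) := by
  have hE := EE_diff (th_diff hℓ)
  have ht := th_diff hℓ
  set L := LL ℓ hℓ with hL
  intro x
  by_cases hx : x ∈ L.lattice
  · have hs : DifferentiableAt ℂ (dslope (th ℓ) x) x :=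
      (((Complex.differentiableOn_dslope Filter.univ_mem).mpr ht.differentiableOn) x
        (Set.mem_univ x)).differentiableAt Filter.univ_mem
    have hP : DifferentiableAt ℂ (L.weierstrassPExcept x) x :=
      (L.analyticAt_weierstrassPExcept x).differentiableAt
    have hd : DifferentiableAt ℂ (fun z => EE (th ℓ) z +
        (L.weierstrassPExcept x z - 1 / x ^ 2) * th ℓ z ^ 2 + (dslope (th ℓ) x z) ^ 2) x := by
      have := hE x
      have := ht x
      fun_prop
    refine hd.congr_of_eventuallyEq ?_
    filter_upwards [L.compl_lattice_sdiff_singleton_mem_nhds x] with z hz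
    by_cases hzx : z = x
    · subst hzx
      rw [DD, if_pos hx, EE, th_lattice_zero hℓ hx, dslope_same]
      ring
    · have hzL : z ∉ L.lattice := fun h => hz ⟨h, hzx⟩
      rw [DD, if_neg hzL, dslope_of_ne _ hzx, slope_def_field, th_lattice_zero hℓ hx,
        ← L.weierstrassPExcept_add ⟨x, hx⟩]
      have : z - x ≠ 0 := sub_ne_zero.mpr hzx
      field_simp
      ring
  · have ho : (L.lattice : Set ℂ)ᶜ ∈ nhds x := L.isClosed_lattice.isOpen_compl.mem_nhds hx
    have hP : DifferentiableAt ℂ L.weierstrassP x :=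
      (L.differentiableOn_weierstrassP x hx).differentiableAt ho
    have hd : DifferentiableAt ℂ (fun z => EE (th ℓ) z + L.weierstrassP z * th ℓ z ^ 2) x := by
      have := hE x
      have := ht x
      fun_prop
    refine hd.congr_of_eventuallyEq ?_
    filter_upwards [ho] with z hz
    have hz' : z ∉ (LL ℓ hℓ).lattice := hz
    rw [DD, if_neg hz']

lemma DD_isV (ℓ : ℝ) (hℓ : 0 < ℓ) : IsV ℓ (DD ℓ hℓ) where
  diff := DD_diff ℓ hℓ
  per x := by
    have hm := (LL ℓ hℓ).ω₂_mem_lattice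
    have hw := (LL ℓ hℓ).weierstrassP_add_coe x ⟨_, hm⟩
    have hi := Submodule.add_mem_iff_left (LL ℓ hℓ).lattice (x := x) hm
    change (LL ℓ hℓ).weierstrassP (x + 2 * Real.pi * Complex.I) = _ at hw
    change (x + 2 * Real.pi * Complex.I) ∈ _ ↔ _ at hi
    by_cases hx : x ∈ (LL ℓ hℓ).lattice
    · rw [DD, DD, if_pos hx, if_pos (hi.mpr hx)]
    · rw [DD, DD, if_neg hx, if_neg (fun h => hx (hi.mp h)), EE_th_per hℓ, th_per, hw, neg_sq]
  quasi x := by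
    have hm := (LL ℓ hℓ).ω₁_mem_lattice
    have hw := (LL ℓ hℓ).weierstrassP_add_coe x ⟨_, hm⟩
    have hi := Submodule.add_mem_iff_left (LL ℓ hℓ).lattice (x := x) hm
    change (LL ℓ hℓ).weierstrassP (x + ℓ) = _ at hw
    change (x + ℓ) ∈ _ ↔ _ at hi
    by_cases hx : x ∈ (LL ℓ hℓ).lattice
    · rw [DD, DD, if_pos hx, if_pos (hi.mpr hx), mul_zero]
    · rw [DD, DD, if_neg hx, if_neg (fun h => hx (hi.mp h)), EE_th_quasi hℓ, th_quasi, hw, neg_sq,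
        show 2 * x + (ℓ : ℂ) = (x + ℓ / 2) + (x + ℓ / 2) by ring, Complex.exp_add]
      ring

lemma prod_isV {ℓ : ℝ} (hℓ : 0 < ℓ) (u : ℂ) : IsV ℓ (fun x => th ℓ (x + u) * th ℓ (x - u)) where
  diff := by have := th_diff hℓ; fun_prop
  per x := by
    rw [add_right_comm, add_sub_right_comm, th_per, th_per, neg_mul_neg]
  quasi x := by
    rw [add_right_comm, add_sub_right_comm, th_quasi, th_quasi, neg_mul_neg,
      show 2 * x + (ℓ : ℂ) = (x + u + ℓ / 2) + (x - u + ℓ / 2) by ring,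
      Complex.exp_add (x + u + ℓ / 2)]
    ring

lemma FF_real {ℓ : ℝ} (hℓ : 0 < ℓ) (s : ℝ) : ∃ r : ℝ, 0 < r ∧
    HasSum (fun k : ℤ => Real.exp (-ℓ * k ^ 2 / 2 + s * k)) r ∧ FF ℓ s = r := by
  have h := FF_hasSum hℓ s
  have e : (fun k : ℤ => Complex.exp (-ℓ * k ^ 2 / 2 + s * k)) =
    fun k : ℤ => ((Real.exp (-ℓ * k ^ 2 / 2 + s * k) : ℝ) : ℂ) := by
    ext k; push_cast; rfl
  rw [e] at h
  have hs : Summable (fun k : ℤ => Real.exp (-ℓ * k ^ 2 / 2 + s * k)) :=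
    Complex.summable_ofReal.mp h.summable
  refine ⟨_, ?_, hs.hasSum, h.unique (Complex.hasSum_ofReal.mpr hs.hasSum)⟩
  exact hs.tsum_pos (fun k => (Real.exp_pos _).le) 0 (Real.exp_pos _)

lemma FF_ne {ℓ : ℝ} (hℓ : 0 < ℓ) (s : ℝ) : FF ℓ s ≠ 0 := by
  obtain ⟨r, hr, -, h⟩ := FF_real hℓ s
  rw [h]; exact_mod_cast hr.ne'

lemma main_identity {ℓ : ℝ} (hℓ : 0 < ℓ) : ∃ c : ℂ, ∀ x : ℂ, FF ℓ x ≠ 0 →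
    EE (FF ℓ) x / FF ℓ x ^ 2 =
      c - wp (ℓ : ℂ) (2 * Real.pi * Complex.I) (ℓ / 2 + Real.pi * Complex.I - x) := by
  set z0 : ℂ := ℓ / 2 + Real.pi * Complex.I with hz0
  have hu : th ℓ (-z0) ≠ 0 := by
    unfold th
    rw [← hz0, neg_add_cancel]
    have := FF_ne hℓ 0
    rw [Complex.ofReal_zero] at this
    exact mul_ne_zero (Complex.exp_ne_zero _) this
  have hT : IsV ℓ (fun x => th ℓ x ^ 2) := by
    have := prod_isV hℓ 0
    simpa only [add_zero, sub_zero, ← sq] using this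
  obtain ⟨c, hc⟩ := IsV.dep (prod_isV hℓ (-z0)) (DD_isV ℓ hℓ) hT
    (by
      rw [zero_add, zero_sub, th_odd ℓ (-z0)]
      exact mul_ne_zero hu (neg_ne_zero.mpr hu))
    (by rw [DD, if_pos (zero_mem _)]) (by rw [th_zero]; norm_num) (-z0) (pow_ne_zero 2 hu)
  refine ⟨c, fun x hx => ?_⟩
  have hth : th ℓ (x - z0) = Complex.exp (-1 / 2 * (x - z0)) * FF ℓ x := by
    unfold th; rw [← hz0, sub_add_cancel]
  have hne : Complex.exp (-1 / 2 * (x - z0)) ≠ 0 := Complex.exp_ne_zero _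
  have hnl : x - z0 ∉ (LL ℓ hℓ).lattice := by
    intro h
    have := th_lattice_zero hℓ h
    rw [hth] at this
    exact (mul_ne_zero hne hx) this
  have h := hc (x - z0)
  rw [DD, if_neg hnl, EE_th_eq hℓ, ← hz0, sub_add_cancel] at h
  simp only [hth] at h
  rw [wp_eq ℓ hℓ, ← (LL ℓ hℓ).weierstrassP_neg, neg_sub]
  generalize (LL ℓ hℓ).weierstrassP (x - z0) = P at h ⊢
  rw [div_eq_iff (pow_ne_zero 2 hx)]
  have h2 : Complex.exp (-1 / 2 * (x - z0)) ^ 2 ≠ 0 := pow_ne_zero 2 hne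
  apply mul_left_cancel₀ h2
  linear_combination h

lemma real_cx_deriv {R : ℝ → ℝ} {G : ℂ → ℂ} {t : ℝ} (hG : DifferentiableAt ℂ G t)
    (h : ∀ t : ℝ, (R t : ℂ) = G t) :
    HasDerivAt R (deriv G t).re t ∧ ((deriv R t : ℝ) : ℂ) = deriv G t := by
  have h1 : HasDerivAt R (deriv G t).re t := by
    have := hG.hasDerivAt.real_of_complex
    refine this.congr_of_eventuallyEq (Filter.Eventually.of_forall fun x => ?_)
    simp [← h]
  refine ⟨h1, ?_⟩
  have h2 := h1.ofReal_comp
  have h3 := hG.hasDerivAt.comp_ofReal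
  simp only [← h] at h3
  rw [h1.deriv]
  exact h2.unique h3

lemma real_cx (m : ℕ) : ∀ (R : ℝ → ℝ) (G : ℂ → ℂ), (∀ t : ℝ, AnalyticAt ℂ G t) →
    (∀ t : ℝ, (R t : ℂ) = G t) → ∀ t : ℝ, ((iteratedDeriv m R t : ℝ) : ℂ) = iteratedDeriv m G t := by
  induction m with
  | zero => intro R G _ h t; simpa using h t
  | succ m ih =>
    intro R G hG h t
    rw [iteratedDeriv_succ', iteratedDeriv_succ']
    exact ih _ _ (fun t => (hG t).deriv)
      (fun t => (real_cx_deriv (hG t).differentiableAt h).2) t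

end DiscGauss

open DiscGauss in
/-- Section 3.7: the cumulants of order `n ≥ 3` of the centered discrete
Gaussian distribution equal `(−1)^{n−1} ℘^{(n−2)}(z_μ;Λ_ℓ)`. -/
theorem stmt12 (ℓ μ : ℝ) (hℓ : 0 < ℓ)
    (p : ℤ → ℝ) (hp : ∀ k : ℤ, p k = Real.exp (-ℓ * ((k : ℝ) - μ) ^ 2 / 2))
    (Z a : ℝ) (hZ : Z = ∑' k : ℤ, p k)
    (ha : a = Z⁻¹ * ∑' k : ℤ, (k : ℝ) * p k)
    (K : ℝ → ℝ)
    (hK : ∀ t : ℝ, K t = Real.log (Z⁻¹ * ∑' k : ℤ, p k * Real.exp (t * ((k : ℝ) - a)))) :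
    ∀ n : ℕ, 3 ≤ n →
      ((iteratedDeriv n K 0 : ℝ) : ℂ) =
        (-1 : ℂ) ^ (n - 1) *
          iteratedDeriv (n - 2) (wp (ℓ : ℂ) (2 * Real.pi * Complex.I)) (zmu ℓ μ) := by
  intro n hn
  obtain ⟨m, rfl⟩ : ∃ m, n = m + 3 := ⟨n - 3, by omega⟩
  have hFd := FF_diff hℓ
  have hFd' : Differentiable ℂ (deriv (FF ℓ)) := hFd.deriv
  -- the real theta function
  let RF : ℝ → ℝ := fun t => (FF ℓ (((ℓ * μ + t : ℝ)) : ℂ)).re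
  have hRF : ∀ t : ℝ, 0 < RF t ∧
      HasSum (fun k : ℤ => Real.exp (-ℓ * k ^ 2 / 2 + (ℓ * μ + t) * k)) (RF t) ∧
      ((RF t : ℝ) : ℂ) = FF ℓ (ℓ * μ + t) := by
    intro t
    obtain ⟨r, hr, hs, h⟩ := FF_real hℓ (ℓ * μ + t)
    have : RF t = r := by simp only [RF, h, Complex.ofReal_re]
    rw [this]
    refine ⟨hr, hs, ?_⟩
    rw [← h]; push_cast; rfl
  have hsum : ∀ b t : ℝ, ∑' k : ℤ, p k * Real.exp (t * ((k : ℝ) - b)) =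
      Real.exp (-ℓ * μ ^ 2 / 2 - t * b) * RF t := by
    intro b t
    rw [← ((hRF t).2.1.mul_left (Real.exp (-ℓ * μ ^ 2 / 2 - t * b))).tsum_eq]
    refine tsum_congr fun k => ?_
    rw [hp, ← Real.exp_add, ← Real.exp_add]
    congr 1; ring
  have hZpos : 0 < Z := by
    have := hsum 0 0
    simp only [zero_mul, Real.exp_zero, mul_one] at this
    rw [hZ, this]
    exact mul_pos (Real.exp_pos _) (hRF 0).1
  have hK' : ∀ t : ℝ, K t = Real.log Z⁻¹ + (-ℓ * μ ^ 2 / 2 - t * a) + Real.log (RF t) := by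
    intro t
    rw [hK, hsum, Real.log_mul (inv_ne_zero hZpos.ne')
      (mul_pos (Real.exp_pos _) (hRF t).1).ne', Real.log_mul (Real.exp_pos _).ne' (hRF t).1.ne',
      Real.log_exp]
    ring
  -- complex side
  have hsh : ∀ z : ℂ, HasDerivAt (fun z => FF ℓ (ℓ * μ + z)) (deriv (FF ℓ) (ℓ * μ + z)) z :=
    fun z => (hFd _).hasDerivAt.comp_const_add _ z
  have hsh' : ∀ z : ℂ, HasDerivAt (fun z => deriv (FF ℓ) (ℓ * μ + z))
      (deriv (deriv (FF ℓ)) (ℓ * μ + z)) z :=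
    fun z => (hFd' _).hasDerivAt.comp_const_add _ z
  let G : ℂ → ℂ := fun z => -a + deriv (FF ℓ) (ℓ * μ + z) / FF ℓ (ℓ * μ + z)
  have hne : ∀ t : ℝ, FF ℓ (ℓ * μ + t) ≠ 0 := by
    intro t
    rw [← (hRF t).2.2]
    exact_mod_cast (hRF t).1.ne'
  have hGK : ∀ t : ℝ, ((deriv K t : ℝ) : ℂ) = G t := by
    intro t
    obtain ⟨h1, h2⟩ := real_cx_deriv (R := RF) (G := fun z => FF ℓ (ℓ * μ + z)) (t := t)
      (hsh t).differentiableAt (fun t => (hRF t).2.2)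
    have h3 : HasDerivAt K (-a + deriv RF t / RF t) t := by
      rw [h1.deriv]
      have hl := h1.log (hRF t).1.ne'
      have ha' : HasDerivAt (fun t : ℝ => Real.log Z⁻¹ + (-ℓ * μ ^ 2 / 2 - t * a)) (-a) t := by
        have := (((hasDerivAt_id t).mul_const a).const_sub (-ℓ * μ ^ 2 / 2)).const_add (Real.log Z⁻¹)
        simpa using this
      refine (ha'.add hl).congr_of_eventuallyEq (Filter.Eventually.of_forall fun x => ?_)
      exact hK' x
    rw [h3.deriv]
    push_cast
    rw [h2, (hRF t).2.2, (hsh t).deriv]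
  have hGan : ∀ t : ℝ, AnalyticAt ℂ G t := by
    intro t
    have a1 : AnalyticAt ℂ (fun z => FF ℓ (ℓ * μ + z)) t :=
      Differentiable.analyticAt (fun z => (hsh z).differentiableAt) _
    have a2 : AnalyticAt ℂ (fun z => deriv (FF ℓ) (ℓ * μ + z)) t :=
      Differentiable.analyticAt (fun z => (hsh' z).differentiableAt) _
    exact analyticAt_const.add (a2.div a1 (hne t))
  obtain ⟨c, hc⟩ := main_identity hℓ
  have hev : deriv G =ᶠ[nhds 0] fun z => c -
      wp (ℓ : ℂ) (2 * Real.pi * Complex.I) (zmu ℓ μ - z) := by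
    have hne0 : FF ℓ (ℓ * μ + 0) ≠ 0 := by simpa using hne 0
    have := (hsh 0).continuousAt.eventually_ne hne0
    filter_upwards [this] with z hz
    have hd := ((hsh' z).div (hsh z) hz).const_add (-a : ℂ)
    refine hd.deriv.trans ?_
    have e : zmu ℓ μ - z = ℓ / 2 + Real.pi * Complex.I - (ℓ * μ + z) := by
      unfold zmu; ring
    rw [e, ← hc _ hz]
    unfold EE
    congr 1
    ring
  have hfin := real_cx (m + 2) (deriv K) G hGan hGK 0
  rw [← iteratedDeriv_succ'] at hfin
  rw [hfin, iteratedDeriv_succ', Complex.ofReal_zero, hev.iteratedDeriv_eq,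
    iteratedDeriv_const_sub (by omega), iteratedDeriv_neg, iteratedDeriv_comp_const_sub]
  simp only [sub_zero, smul_eq_mul]
  rw [show m + 3 - 1 = (m + 1) + 1 by omega, show m + 3 - 2 = m + 1 by omega, pow_succ (-1 : ℂ) (m + 1)]
  ring
end

section
/- Let ℓ > 0 and let a, m ∈ ℝ with ℘(ℓ/2; Λ_ℓ) + a > 0. Suppose there exists an open neighborhood U ⊂ ℂ of ℓ/4 such that for every z₁ ∈ U with 2z₁ ∉ Λ_ℓ, every zero of the holomorphic function z ↦ m² + 4·(℘(2z₁;Λ_ℓ)+a)·(℘(z+z₁;Λ_ℓ)+a)·(℘(z−z₁;Λ_ℓ)+a), defined on {z ∈ ℂ : z+z₁ ∉ Λ_ℓ and z−z₁ ∉ Λ_ℓ}, has even order. Then m² = −4·(℘(ℓ/2;Λ_ℓ)+a)·(℘(πi;Λ_ℓ)+a)·(℘(ℓ/2+πi;Λ_ℓ)+a). -/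
open Complex

open Filter Topology in
theorem liouville_aux (L : PeriodPair) (f : ℂ → ℂ)
    (hf : ∀ x, ∃ g : ℂ → ℂ, AnalyticAt ℂ g x ∧ f =ᶠ[𝓝[≠] x] g)
    (hper : ∀ z, ∀ l ∈ L.lattice, f (z + l) = f z) :
    ∃ c, ∀ z, ContinuousAt f z → f z = c := by
  have hm : Meromorphic f := fun x => by
    obtain ⟨g, hg, hfg⟩ := hf x
    exact hg.meromorphicAt.congr hfg.symm
  have hmo : MeromorphicOn f Set.univ := fun x _ => hm x
  set F := toMeromorphicNFOn f Set.univ with hF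
  have hFf : ∀ x, F =ᶠ[𝓝[≠] x] f := fun x =>
    hmo.toMeromorphicNFOn_eq_self_on_nhdsNE (Set.mem_univ x)
  have hFa : ∀ x, AnalyticAt ℂ F x := fun x => by
    have h1 : MeromorphicNFAt F x := meromorphicNFOn_toMeromorphicNFOn f Set.univ (Set.mem_univ x)
    rw [← h1.meromorphicOrderAt_nonneg_iff_analyticAt, meromorphicOrderAt_congr (hFf x),
      (hm x).meromorphicOrderAt_nonneg_iff]
    exact hf x
  have hFd : Differentiable ℂ F := fun x => (hFa x).differentiableAt
  have hFc := hFd.continuous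
  have hFper : ∀ z, ∀ w ∈ L.lattice, F (z + w) = F z := by
    intro z w hw
    have h1 : Tendsto (fun y => F (y + w)) (𝓝[≠] z) (𝓝 (F (z + w))) :=
      ((hFc.comp (continuous_id.add continuous_const)).tendsto z).mono_left nhdsWithin_le_nhds
    have h2 : Tendsto F (𝓝[≠] z) (𝓝 (F z)) := (hFc.tendsto z).mono_left nhdsWithin_le_nhds
    refine tendsto_nhds_unique h1 (h2.congr' ?_)
    have ht : Tendsto (fun y => y + w) (𝓝[≠] z) (𝓝[≠] (z + w)) := by
      refine tendsto_nhdsWithin_iff.2 ⟨((continuous_id.add continuous_const).tendsto z).mono_left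
        nhdsWithin_le_nhds, ?_⟩
      filter_upwards [self_mem_nhdsWithin] with y hy
      simpa using hy
    filter_upwards [hFf z, ht.eventually (hFf (z + w))] with y h3 h4
    rw [h3, h4, hper y w hw]
  refine ⟨F 0, fun z hz => ?_⟩
  have hb := hFd.apply_eq_apply_of_bounded (IsZLattice.isCompact_range_of_periodic L.lattice F hFc
    fun z w hw ↦ hFper z w hw).isBounded z 0
  rw [← hb]
  have h1 : Tendsto f (𝓝[≠] z) (𝓝 (f z)) := hz.tendsto.mono_left nhdsWithin_le_nhds
  have h2 : Tendsto F (𝓝[≠] z) (𝓝 (F z)) := (hFc.tendsto z).mono_left nhdsWithin_le_nhds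
  exact tendsto_nhds_unique h1 (h2.congr' (hFf z))

namespace PeriodPair
open Filter Topology

theorem wP_add (L : PeriodPair) (z l : ℂ) (hl : l ∈ L.lattice) :
    L.weierstrassP (z + l) = L.weierstrassP z := L.weierstrassP_add_coe z ⟨l, hl⟩

theorem wP_analytic (L : PeriodPair) {z : ℂ} (hz : z ∉ L.lattice) :
    AnalyticAt ℂ L.weierstrassP z := L.analyticOnNhd_weierstrassP z hz

theorem wP_hasDerivAt (L : PeriodPair) {z : ℂ} (hz : z ∉ L.lattice) :
    HasDerivAt L.weierstrassP (L.derivWeierstrassP z) z := by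
  rw [← L.deriv_weierstrassP]
  exact (L.wP_analytic hz).differentiableAt.hasDerivAt

theorem wP_nhds (L : PeriodPair) {z : ℂ} (hz : z ∉ L.lattice) :
    ∀ᶠ y in 𝓝 z, y ∉ L.lattice := L.isClosed_lattice.isOpen_compl.mem_nhds hz

theorem wP_nhdsNE (L : PeriodPair) (z : ℂ) :
    ∀ᶠ y in 𝓝[≠] z, y ∉ L.lattice := by
  have := L.compl_lattice_sdiff_singleton_mem_nhds z
  filter_upwards [nhdsWithin_le_nhds this, self_mem_nhdsWithin] with y h1 h2 h3
  exact h1 ⟨h3, h2⟩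

/-- `℘ - c` is not locally zero. -/
theorem wP_sub_ne_top (L : PeriodPair) (c z : ℂ) :
    ∀ᶠ y in 𝓝[≠] z, L.weierstrassP y - c ≠ 0 := by
  have hm : Meromorphic (fun y => L.weierstrassP y - c) := by
    have := L.meromorphic_weierstrassP
    intro x
    exact (this x).sub (MeromorphicAt.const c x)
  rw [← meromorphicOrderAt_ne_top_iff_eventually_ne_zero (hm z)]
  refine hm.exists_meromorphicOrderAt_ne_top_iff_forall.1 ⟨0, ?_⟩ z
  intro h
  rw [meromorphicOrderAt_eq_top_iff] at h
  have h1 : L.weierstrassP =ᶠ[𝓝[≠] 0] fun _ => c := by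
    filter_upwards [h] with y hy using sub_eq_zero.1 hy
  have h2 := meromorphicOrderAt_congr h1
  rw [L.order_weierstrassP 0 L.lattice.zero_mem] at h2
  have h3 : 0 ≤ meromorphicOrderAt (fun _ : ℂ => c) 0 :=
    (analyticAt_const).meromorphicOrderAt_nonneg
  rw [← h2] at h3
  exact absurd h3 (by decide)

theorem wP_surj (L : PeriodPair) (c : ℂ) : ∃ z, z ∉ L.lattice ∧ L.weierstrassP z = c := by
  by_contra! hne
  have hm : Meromorphic (fun y => (L.weierstrassP y - c)) := by
    have := L.meromorphic_weierstrassP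
    intro x
    exact (this x).sub (MeromorphicAt.const c x)
  have han : ∀ x, x ∉ L.lattice → AnalyticAt ℂ (fun y => (L.weierstrassP y - c)⁻¹) x := by
    intro x hx
    exact ((L.wP_analytic hx).sub analyticAt_const).inv (sub_ne_zero.2 (hne x hx))
  obtain ⟨C, hC⟩ := liouville_aux L (fun y => (L.weierstrassP y - c)⁻¹) (by
    intro x
    by_cases hx : x ∈ L.lattice
    · refine ⟨fun z => (z - x) ^ 2 * ((L.weierstrassPExcept x z - 1 / x ^ 2 - c) * (z - x) ^ 2 + 1)⁻¹,
        ?_, ?_⟩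
      · have := L.analyticAt_weierstrassPExcept x
        refine AnalyticAt.mul (by fun_prop) (AnalyticAt.inv (by fun_prop) (by simp))
      · filter_upwards [self_mem_nhdsWithin] with z hz
        have hz' : z - x ≠ 0 := sub_ne_zero.2 hz
        have := L.weierstrassPExcept_add ⟨x, hx⟩ z
        simp only at this
        rw [← this]
        have h2 : L.weierstrassPExcept x z + (1 / (z - x) ^ 2 - 1 / x ^ 2) - c
          = ((L.weierstrassPExcept x z - 1 / x ^ 2 - c) * (z - x) ^ 2 + 1) * ((z - x) ^ 2)⁻¹ := by
          generalize 1 / x ^ 2 = q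
          field_simp
          ring
        rw [h2, mul_inv, inv_inv, mul_comm]
    · exact ⟨_, han x hx, EventuallyEq.rfl⟩)
    (by intro z l hl; simp only [L.wP_add z l hl])
  have h1 : ∀ᶠ y in 𝓝[≠] (0 : ℂ), L.weierstrassP y - (c + C⁻¹) = 0 := by
    filter_upwards [L.wP_nhdsNE 0] with y hy
    have := hC y (han y hy).continuousAt
    rw [← this, inv_inv]; ring
  obtain ⟨y, hy1, hy2⟩ := (h1.and (L.wP_sub_ne_top (c + C⁻¹) 0)).exists
  exact hy2 hy1

theorem dP_half (L : PeriodPair) {ω : ℂ} (h2 : 2 * ω ∈ L.lattice) :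
    L.derivWeierstrassP ω = 0 := by
  have h := L.derivWeierstrassP_sub_coe ω ⟨_, h2⟩
  simp only at h
  rw [show ω - 2 * ω = -ω by ring, L.derivWeierstrassP_neg] at h
  linear_combination (-1 / 2) * h

theorem wP_shift (L : PeriodPair) {ω : ℂ} (hω : ω ∉ L.lattice) (h2 : 2 * ω ∈ L.lattice) :
    ∃ κ : ℂ, κ ≠ 0 ∧ ∀ w, w ∉ L.lattice → w - ω ∉ L.lattice →
      (L.weierstrassP w - L.weierstrassP ω) * (L.weierstrassP (w - ω) - L.weierstrassP ω) = κ := by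
  set e := L.weierstrassP ω with he
  set f : ℂ → ℂ := fun w => (L.weierstrassP w - e) * (L.weierstrassP (w - ω) - e) with hfdef
  have hsym : ∀ w, f (w - ω) = f w := by
    intro w
    have : L.weierstrassP (w - ω - ω) = L.weierstrassP w := by
      have := L.wP_add (w - ω - ω) _ h2
      rw [← this]; congr 1; ring
    simp only [hfdef, this, mul_comm]
  have han : ∀ w, w ∉ L.lattice → w - ω ∉ L.lattice → AnalyticAt ℂ f w := by
    intro w h1 h2
    have a1 := L.wP_analytic h1
    have a2 : AnalyticAt ℂ (fun w => L.weierstrassP (w - ω)) w :=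
      (L.wP_analytic h2).fun_comp (f := fun w => w - ω) (by fun_prop)
    exact (a1.sub analyticAt_const).mul (a2.sub analyticAt_const)
  have hlat : ∀ x ∈ L.lattice, ∃ g : ℂ → ℂ, AnalyticAt ℂ g x ∧ f =ᶠ[𝓝[≠] x] g := by
    intro x hx
    have hxω : x - ω ∉ L.lattice := fun h => hω (by simpa using L.lattice.sub_mem hx h)
    have hval : ∀ y, y - ω = - ω + y := fun y => by ring
    have a2 : AnalyticAt ℂ (fun w => L.weierstrassP (w - ω) - e) x :=
      ((L.wP_analytic hxω).fun_comp (f := fun w => w - ω) (by fun_prop)).sub analyticAt_const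
    have hB0 : L.weierstrassP (x - ω) - e = 0 := by
      rw [hval, L.wP_add _ _ hx, L.weierstrassP_neg]; simp [he]
    have hB1 : deriv (fun w => L.weierstrassP (w - ω) - e) x = 0 := by
      have h3 : L.derivWeierstrassP (x - ω) = 0 := by
        apply L.dP_half
        have := L.lattice.sub_mem (L.lattice.add_mem hx hx) h2
        convert this using 1; ring
      have h4 := ((L.wP_hasDerivAt hxω).comp_sub_const x ω).sub_const e
      rw [h4.deriv, h3]
    have hord : (2 : ℕ) ≤ analyticOrderAt (fun w => L.weierstrassP (w - ω) - e) x := by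
      rw [natCast_le_analyticOrderAt_iff_iteratedDeriv_eq_zero a2]
      intro i hi
      interval_cases i
      · simpa using hB0
      · simpa using hB1
    obtain ⟨C, hC, hCe⟩ := (natCast_le_analyticOrderAt a2).1 hord
    refine ⟨fun z => ((L.weierstrassPExcept x z - 1 / x ^ 2 - e) * (z - x) ^ 2 + 1) * C z, ?_, ?_⟩
    · have := L.analyticAt_weierstrassPExcept x
      fun_prop
    · filter_upwards [self_mem_nhdsWithin, nhdsWithin_le_nhds hCe] with z hz hCz
      have hz' : z - x ≠ 0 := sub_ne_zero.2 hz
      have := L.weierstrassPExcept_add ⟨x, hx⟩ z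
      simp only at this
      simp only [hfdef, hCz]
      rw [← this, smul_eq_mul]
      generalize 1 / x ^ 2 = q
      field_simp
      ring
  obtain ⟨κ, hκ⟩ := liouville_aux L f (by
    intro x
    by_cases hx : x ∈ L.lattice
    · exact hlat x hx
    by_cases hx2 : x - ω ∈ L.lattice
    · obtain ⟨g, hg, hfg⟩ := hlat _ hx2
      refine ⟨fun z => g (z - ω), hg.fun_comp (f := fun w => w - ω) (by fun_prop), ?_⟩
      have ht : Tendsto (fun y => y - ω) (𝓝[≠] x) (𝓝[≠] (x - ω)) := by
        refine tendsto_nhdsWithin_iff.2 ⟨((continuous_id.sub continuous_const).tendsto x).mono_left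
          nhdsWithin_le_nhds, ?_⟩
        filter_upwards [self_mem_nhdsWithin] with y hy
        simpa [sub_left_inj] using hy
      filter_upwards [ht.eventually hfg] with y hy
      rw [← hy, hsym]
    · exact ⟨f, han x hx hx2, EventuallyEq.rfl⟩)
    (by
      intro z l hl
      have h3 : L.weierstrassP (z + l - ω) = L.weierstrassP (z - ω) := by
        rw [← L.wP_add (z - ω) l hl]; congr 1; ring
      simp only [hfdef, L.wP_add z l hl, h3])
  refine ⟨κ, ?_, fun w h1 h2 => hκ w (han w h1 h2).continuousAt⟩
  have ht : Tendsto (fun y => y - ω) (𝓝[≠] 0) (𝓝[≠] (0 - ω)) := by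
    refine tendsto_nhdsWithin_iff.2 ⟨((continuous_id.sub continuous_const).tendsto 0).mono_left
      nhdsWithin_le_nhds, ?_⟩
    filter_upwards [self_mem_nhdsWithin] with y hy
    simpa using hy
  obtain ⟨y, ⟨h1, h2⟩, h3, h4⟩ := (((L.wP_nhdsNE 0).and (ht.eventually (L.wP_nhdsNE _))).and
    ((L.wP_sub_ne_top e 0).and (ht.eventually (L.wP_sub_ne_top e _)))).exists
  rw [← hκ y (han y h1 h2).continuousAt]
  exact mul_ne_zero h3 h4

/-- Factorisation of the cubic. -/
theorem dP_sq_factor (L : PeriodPair) {ω₁ ω₂ : ℂ} (h1 : ω₁ ∉ L.lattice) (h2 : ω₂ ∉ L.lattice)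
    (h12 : ω₂ - ω₁ ∉ L.lattice) (d1 : 2 * ω₁ ∈ L.lattice) (d2 : 2 * ω₂ ∈ L.lattice) :
    ∃ κ : ℂ, κ ≠ 0 ∧ (∀ w, w ∉ L.lattice → w - ω₁ ∉ L.lattice →
      (L.weierstrassP w - L.weierstrassP ω₁) * (L.weierstrassP (w - ω₁) - L.weierstrassP ω₁) = κ) ∧
    (L.weierstrassP ω₂ - L.weierstrassP ω₁) *
      (L.weierstrassP (ω₁ + ω₂) - L.weierstrassP ω₁) = κ ∧
    ∀ z, z ∉ L.lattice → L.derivWeierstrassP z ^ 2 = 4 * (L.weierstrassP z - L.weierstrassP ω₁) *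
      (L.weierstrassP z - L.weierstrassP ω₂) * (L.weierstrassP z - L.weierstrassP (ω₁ + ω₂)) := by
  have h3 : ω₁ + ω₂ ∉ L.lattice := fun h => h12 (by
    have := L.lattice.sub_mem h d1
    convert this using 1; ring)
  have d3 : 2 * (ω₁ + ω₂) ∈ L.lattice := by
    rw [mul_add]; exact L.lattice.add_mem d1 d2
  have e1 : L.weierstrassP (ω₂ - ω₁) = L.weierstrassP (ω₁ + ω₂) := by
    rw [← L.wP_add (ω₂ - ω₁) _ d1]; congr 1; ring
  have e2 : L.weierstrassP (ω₁ - ω₂) = L.weierstrassP (ω₁ + ω₂) := by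
    rw [← L.wP_add (ω₁ - ω₂) _ d2]; congr 1; ring
  have h21 : ω₁ - ω₂ ∉ L.lattice := fun h => h12 (by simpa using L.lattice.neg_mem h)
  obtain ⟨κ, hκ, hs⟩ := L.wP_shift h1 d1
  obtain ⟨κ', hκ', hs'⟩ := L.wP_shift h2 d2
  have k1 := hs ω₂ h2 h12
  have k2 := hs' ω₁ h1 h21
  rw [e1] at k1
  rw [e2] at k2
  refine ⟨κ, hκ, hs, k1, fun z hz => ?_⟩
  have r1 := L.derivWeierstrassP_sq _ h1
  have r2 := L.derivWeierstrassP_sq _ h2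
  have r3 := L.derivWeierstrassP_sq _ h3
  have rz := L.derivWeierstrassP_sq _ hz
  rw [L.dP_half d1] at r1
  rw [L.dP_half d2] at r2
  rw [L.dP_half d3] at r3
  rw [rz]
  generalize L.weierstrassP ω₁ = a at *
  generalize L.weierstrassP ω₂ = b at *
  generalize L.weierstrassP (ω₁ + ω₂) = c at *
  generalize L.weierstrassP z = x at *
  have ba : b - a ≠ 0 := fun h => hκ (by rw [← k1, h, zero_mul])
  have ca : c - a ≠ 0 := fun h => hκ (by rw [← k1, h, mul_zero])
  have cb : c - b ≠ 0 := fun h => hκ' (by rw [← k2, h, mul_zero])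
  have q1 : 4 * (a ^ 2 + a * b + b ^ 2) - L.g₂ = 0 := by
    apply mul_left_cancel₀ ba; linear_combination r1 - r2
  have q2 : 4 * (a ^ 2 + a * c + c ^ 2) - L.g₂ = 0 := by
    apply mul_left_cancel₀ ca; linear_combination r1 - r3
  have q3 : a + b + c = 0 := by
    apply mul_left_cancel₀ cb; linear_combination (q2 - q1) / 4
  have hc : c = - a - b := by linear_combination q3
  have hg : L.g₂ = 4 * (a ^ 2 + a * b + b ^ 2) := by linear_combination -q1
  have hg3 : L.g₃ = 4 * a ^ 3 - L.g₂ * a := by linear_combination r1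
  rw [hg3, hg, hc]; ring

end PeriodPair

/-- The period pair `(ℓ, 2πi)`. -/
noncomputable def ellPair (ℓ : ℝ) (hℓ : 0 < ℓ) : PeriodPair where
  ω₁ := (ℓ : ℂ)
  ω₂ := 2 * Real.pi * Complex.I
  indep := by
    rw [LinearIndependent.pair_iff]
    intro s t h
    have h1 := congrArg Complex.re h
    have h2 := congrArg Complex.im h
    simp at h1 h2
    exact ⟨h1.resolve_right hℓ.ne', h2⟩

theorem lat_eq (ℓ : ℝ) (hℓ : 0 < ℓ) (z : ℂ) :
    z ∈ lat (ℓ : ℂ) (2 * Real.pi * Complex.I) ↔ z ∈ (ellPair ℓ hℓ).lattice := by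
  rw [PeriodPair.mem_lattice]
  simp only [lat, ellPair, Set.mem_ofPred_eq, eq_comm]

theorem wp_eq_wP (L : PeriodPair) (z : ℂ) : wp L.ω₁ L.ω₂ z = L.weierstrassP z := by
  have h := L.weierstrassPExcept_add 0 z
  rw [← h]
  simp only [ZeroMemClass.coe_zero, sub_zero]
  have h2 : L.weierstrassPExcept 0 z = ∑' p : {p : ℤ × ℤ // p ≠ 0},
    (1 / (z - ((p.1.1 : ℂ) * L.ω₁ + (p.1.2 : ℂ) * L.ω₂)) ^ 2
      - 1 / ((p.1.1 : ℂ) * L.ω₁ + (p.1.2 : ℂ) * L.ω₂) ^ 2) := by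
    have h3 := tsum_subtype {p : ℤ × ℤ | p ≠ 0} (fun p : ℤ × ℤ =>
      (1 / (z - ((p.1 : ℂ) * L.ω₁ + (p.2 : ℂ) * L.ω₂)) ^ 2
      - 1 / ((p.1 : ℂ) * L.ω₁ + (p.2 : ℂ) * L.ω₂) ^ 2))
    refine Eq.trans ?_ h3.symm
    unfold PeriodPair.weierstrassPExcept
    rw [← L.latticeEquivProd.symm.toEquiv.tsum_eq]
    refine tsum_congr fun p => ?_
    have h4 := L.latticeEquiv_symm_apply p
    by_cases hp : p = 0
    · subst hp
      simp
    · have h5 : ((L.latticeEquivProd.symm p : L.lattice) : ℂ) ≠ 0 := by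
        simpa using hp
      rw [Set.indicator_of_mem (by exact hp)]
      simp only [LinearEquiv.coe_toEquiv] at *
      rw [if_neg h5, h4]
  rw [h2]
  unfold wp
  simp
  ring

theorem wp_real (ℓ x : ℝ) :
    ∃ s : ℝ, wp (ℓ : ℂ) (2 * Real.pi * Complex.I) (x : ℂ) = s := by
  suffices h : (starRingEnd ℂ) (wp (ℓ : ℂ) (2 * Real.pi * Complex.I) (x : ℂ)) =
      wp (ℓ : ℂ) (2 * Real.pi * Complex.I) (x : ℂ) from
    ⟨_, (Complex.conj_eq_iff_re.1 h).symm⟩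
  unfold wp
  rw [map_add, Complex.conj_tsum]
  congr 1
  · simp
  let e : {p : ℤ × ℤ // p ≠ 0} ≃ {p : ℤ × ℤ // p ≠ 0} :=
    { toFun := fun p => ⟨(p.1.1, -p.1.2), by
        have := p.2
        simpa [Prod.ext_iff] using this⟩
      invFun := fun p => ⟨(p.1.1, -p.1.2), by
        have := p.2
        simpa [Prod.ext_iff] using this⟩
      left_inv := fun p => by simp
      right_inv := fun p => by simp }
  rw [← e.tsum_eq]
  refine tsum_congr fun p => ?_
  have h2 : (starRingEnd ℂ) 2 = 2 := Complex.conj_ofNat 2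
  simp [e, h2]

open Filter Topology in
theorem simple_zero (F : ℂ → ℂ) (z₀ F' : ℂ) (ha : AnalyticAt ℂ F z₀) (h0 : F z₀ = 0)
    (hd : HasDerivAt F F' z₀) (hF' : F' ≠ 0) :
    ∃ h : ℂ → ℂ, AnalyticAt ℂ h z₀ ∧ h z₀ ≠ 0 ∧ ∀ᶠ z in 𝓝 z₀, F z = (z - z₀) ^ 1 * h z := by
  refine ⟨dslope F z₀, ?_, ?_, ?_⟩
  · obtain ⟨p, hp⟩ := ha
    exact ⟨_, hp.has_fpower_series_dslope_fslope⟩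
  · rw [dslope_same, hd.deriv]; exact hF'
  · refine Eventually.of_forall fun z => ?_
    have := sub_smul_dslope F z₀ z
    rw [h0, sub_zero, smul_eq_mul] at this
    rw [pow_one, this]

open Filter Topology in
theorem core (L : PeriodPair) (ω₁ ω₂ : ℂ) (a m r s : ℝ) (h1 : ω₁ ∉ L.lattice)
    (h2 : ω₂ ∉ L.lattice)
    (h12 : ω₂ - ω₁ ∉ L.lattice) (d1 : 2 * ω₁ ∈ L.lattice) (d2 : 2 * ω₂ ∈ L.lattice)
    (h4 : ω₁ / 2 ∉ L.lattice)
    (hr : 0 < r) (hE : L.weierstrassP ω₁ + a = r)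
    (hs : L.weierstrassP (ω₁ / 2) = s)
    (U : Set ℂ) (hU : IsOpen U) (hmem : ω₁ / 2 ∈ U)
    (heven : ∀ z₁ ∈ U, 2 * z₁ ∉ L.lattice → ∀ z₀ : ℂ, z₀ + z₁ ∉ L.lattice →
          z₀ - z₁ ∉ L.lattice →
            ¬∃ h : ℂ → ℂ, AnalyticAt ℂ h z₀ ∧ h z₀ ≠ 0 ∧
              (∀ᶠ z in nhds z₀,
                (m : ℂ) ^ 2 + 4 * (L.weierstrassP (2 * z₁) + (a : ℂ))
                  * (L.weierstrassP (z + z₁) + (a : ℂ))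
                  * (L.weierstrassP (z - z₁) + (a : ℂ))
                = (z - z₀) ^ 1 * h z)) :
    (m : ℂ) ^ 2 =
      -4 * (L.weierstrassP ω₁ + (a : ℂ)) * (L.weierstrassP ω₂ + (a : ℂ))
        * (L.weierstrassP (ω₁ + ω₂) + (a : ℂ)) := by
  obtain ⟨κ, hκ, hshift, hk, hfac⟩ := L.dP_sq_factor h1 h2 h12 d1 d2
  have hr0 : (r : ℂ) ≠ 0 := by exact_mod_cast hr.ne'
  have hAn : ∀ z₁ z₀ : ℂ, z₀ + z₁ ∉ L.lattice → z₀ - z₁ ∉ L.lattice →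
      AnalyticAt ℂ (fun z => (m : ℂ) ^ 2 + 4 * (L.weierstrassP (2 * z₁) + (a : ℂ))
                  * (L.weierstrassP (z + z₁) + (a : ℂ))
                  * (L.weierstrassP (z - z₁) + (a : ℂ))) z₀ := by
    intro z₁ z₀ hp hq
    have a1 : AnalyticAt ℂ (fun z => L.weierstrassP (z + z₁)) z₀ :=
      (L.wP_analytic hp).fun_comp (f := fun z => z + z₁) (by fun_prop)
    have a2 : AnalyticAt ℂ (fun z => L.weierstrassP (z - z₁)) z₀ :=
      (L.wP_analytic hq).fun_comp (f := fun z => z - z₁) (by fun_prop)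
    fun_prop
  have hDer : ∀ z₁ z₀ : ℂ, z₀ + z₁ ∉ L.lattice → z₀ - z₁ ∉ L.lattice →
      HasDerivAt (fun z => (m : ℂ) ^ 2 + 4 * (L.weierstrassP (2 * z₁) + (a : ℂ))
                  * (L.weierstrassP (z + z₁) + (a : ℂ))
                  * (L.weierstrassP (z - z₁) + (a : ℂ)))
        (4 * (L.weierstrassP (2 * z₁) + (a : ℂ)) * L.derivWeierstrassP (z₀ + z₁)
            * (L.weierstrassP (z₀ - z₁) + (a : ℂ)) +
          4 * (L.weierstrassP (2 * z₁) + (a : ℂ)) * (L.weierstrassP (z₀ + z₁) + (a : ℂ))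
            * L.derivWeierstrassP (z₀ - z₁)) z₀ := by
    intro z₁ z₀ hp hq
    have a1 := ((L.wP_hasDerivAt hp).comp_add_const z₀ z₁).add_const (a : ℂ)
    have a2 := ((L.wP_hasDerivAt hq).comp_sub_const z₀ z₁).add_const (a : ℂ)
    exact ((a1.const_mul (4 * (L.weierstrassP (2 * z₁) + (a : ℂ)))).mul a2).const_add _
  by_cases hm : m = 0
  · -- the case `m = 0`
    subst hm
    by_contra hcon
    obtain ⟨ζ, hζ, hPζ⟩ := L.wP_surj (-(a : ℂ))
    have hdζ : L.derivWeierstrassP ζ ≠ 0 := by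
      intro h0
      have := hfac ζ hζ
      rw [h0, hPζ] at this
      apply hcon
      push_cast
      linear_combination this
    have hA : ∀ᶠ z₁ in 𝓝 (ω₁ / 2), z₁ ∈ U ∧ 2 * z₁ ∉ L.lattice ∧
        L.weierstrassP (2 * z₁) + a ≠ 0 := by
      have ht : Tendsto (fun z : ℂ => 2 * z) (𝓝 (ω₁ / 2)) (𝓝 ω₁) := by
        have : Continuous (fun z : ℂ => 2 * z) := by fun_prop
        have h := this.tendsto (ω₁ / 2)
        rwa [mul_div_cancel₀ _ (two_ne_zero)] at h
      have hc : ContinuousAt (fun z => L.weierstrassP z + a) ω₁ :=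
        (L.wP_analytic h1).continuousAt.add continuousAt_const
      have hne : ∀ᶠ z in 𝓝 ω₁, L.weierstrassP z + a ≠ 0 :=
        hc.eventually_ne (by rw [hE]; exact hr0)
      exact (hU.eventually_mem hmem).and ((ht.eventually (L.wP_nhds h1)).and (ht.eventually hne))
    have hB : ∀ᶠ z₁ in 𝓝[≠] (ω₁ / 2), ζ - 2 * z₁ ∉ L.lattice ∧
        L.weierstrassP (ζ - 2 * z₁) - (-(a : ℂ)) ≠ 0 := by
      have ht : Tendsto (fun z : ℂ => ζ - 2 * z) (𝓝[≠] (ω₁ / 2)) (𝓝[≠] (ζ - 2 * (ω₁ / 2))) := by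
        have hc : Continuous (fun z : ℂ => ζ - 2 * z) := by fun_prop
        refine tendsto_nhdsWithin_iff.2 ⟨(hc.tendsto _).mono_left nhdsWithin_le_nhds, ?_⟩
        filter_upwards [self_mem_nhdsWithin] with y hy h
        apply hy
        have h' : ζ - 2 * y = ζ - 2 * (ω₁ / 2) := h
        show y = ω₁ / 2
        linear_combination (-1 / 2) * h'
      exact (ht.eventually (L.wP_nhdsNE _)).and (ht.eventually (L.wP_sub_ne_top _ _))
    obtain ⟨z₁, ⟨hz1, hz2, hz3⟩, hz4, hz5⟩ := ((hA.filter_mono nhdsWithin_le_nhds).and hB).exists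
    rw [sub_neg_eq_add] at hz5
    have p1 : ζ - z₁ + z₁ = ζ := by ring
    have p2 : ζ - z₁ - z₁ = ζ - 2 * z₁ := by ring
    have hp : ζ - z₁ + z₁ ∉ L.lattice := by rwa [p1]
    have hq : ζ - z₁ - z₁ ∉ L.lattice := by rwa [p2]
    refine heven z₁ hz1 hz2 (ζ - z₁) hp hq
      (simple_zero _ _ _ (hAn z₁ _ hp hq) ?_ (hDer z₁ _ hp hq) ?_)
    · simp only [p1, hPζ]; simp
    · rw [p1, p2, hPζ]
      simp only [neg_add_cancel, mul_zero, zero_mul, add_zero]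
      exact mul_ne_zero (mul_ne_zero (mul_ne_zero (by norm_num) hz3) hdζ) hz5
  · -- the case `m ≠ 0`
    set e := L.weierstrassP ω₁ with he
    have hee : e = r - a := by rw [← hE]; ring
    obtain ⟨x, hx⟩ : ∃ x : ℂ, (4 * (r : ℂ) ^ 2) * (x * x) + ((m : ℂ) ^ 2 + 4 * r * (κ + r ^ 2)) * x
        + 4 * r ^ 2 * κ = 0 := by
      apply exists_quadratic_eq_zero (by simp [hr0])
      obtain ⟨d, hd⟩ := IsAlgClosed.exists_pow_nat_eq
        (discrim (4 * (r : ℂ) ^ 2) ((m : ℂ) ^ 2 + 4 * r * (κ + r ^ 2)) (4 * r ^ 2 * κ))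
        (n := 2) (by norm_num)
      exact ⟨d, by rw [← hd]; ring⟩
    have hx0 : x ≠ 0 := by
      rintro rfl
      simp [hr0, hκ] at hx
    obtain ⟨w, hw, hPw⟩ := L.wP_surj (e + x)
    have hw2 : w - ω₁ ∉ L.lattice := by
      intro h
      have := L.wP_add ω₁ _ h
      rw [show ω₁ + (w - ω₁) = w by ring, hPw] at this
      exact hx0 (by linear_combination this)
    have hsh := hshift w hw hw2
    rw [hPw] at hsh
    have hX : L.weierstrassP (w - ω₁) = e + κ / x := by
      field_simp
      linear_combination hsh
    by_cases hdw : L.derivWeierstrassP w = 0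
    · have := hfac w hw
      rw [hdw, hPw] at this
      have h3 : (e + x - L.weierstrassP ω₂) * (e + x - L.weierstrassP (ω₁ + ω₂)) = 0 := by
        have h4 : (4 * x) * ((e + x - L.weierstrassP ω₂) * (e + x - L.weierstrassP (ω₁ + ω₂))) = 0 := by
          linear_combination -this
        exact (mul_eq_zero.1 h4).resolve_left (by simp [hx0])
      rw [hE]
      apply mul_left_cancel₀ hx0
      generalize L.weierstrassP ω₂ = b at *
      generalize L.weierstrassP (ω₁ + ω₂) = c at *
      rcases mul_eq_zero.1 h3 with h5 | h5
      · obtain rfl : b = e + x := by linear_combination -h5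
        have : c = e + κ / x := by field_simp; linear_combination hk
        subst this
        rw [hee]; field_simp; linear_combination hx
      · obtain rfl : c = e + x := by linear_combination -h5
        have : b = e + κ / x := by field_simp; linear_combination hk
        subst this
        rw [hee]; field_simp; linear_combination hx
    · exfalso
      have p0 : 2 * (ω₁ / 2) = ω₁ := by ring
      have p1 : w - ω₁ / 2 + ω₁ / 2 = w := by ring
      have p2 : w - ω₁ / 2 - ω₁ / 2 = w - ω₁ := by ring
      have hp : w - ω₁ / 2 + ω₁ / 2 ∉ L.lattice := by rwa [p1]
      have hq : w - ω₁ / 2 - ω₁ / 2 ∉ L.lattice := by rwa [p2]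
      -- derivative of the shift relation
      have hder : L.derivWeierstrassP w * (κ / x) + x * L.derivWeierstrassP (w - ω₁) = 0 := by
        have b1 := (L.wP_hasDerivAt hw).sub_const e
        have b2 := ((L.wP_hasDerivAt hw2).comp_sub_const w ω₁).sub_const e
        have b3 := b1.mul b2
        have b4 : HasDerivAt (fun w => (L.weierstrassP w - e) * (L.weierstrassP (w - ω₁) - e))
            0 w := by
          refine (hasDerivAt_const w κ).congr_of_eventuallyEq ?_
          have ht : Tendsto (fun z : ℂ => z - ω₁) (𝓝 w) (𝓝 (w - ω₁)) := by
            have : Continuous (fun z : ℂ => z - ω₁) := by fun_prop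
            exact this.tendsto w
          filter_upwards [L.wP_nhds hw, ht.eventually (L.wP_nhds hw2)] with y hy1 hy2
          exact hshift y hy1 hy2
        have b5 := b3.unique b4
        rw [hPw, hX] at b5
        linear_combination b5
      -- the special value
      have hs2 : ((s : ℂ) - e) ^ 2 = κ := by
        have h5 : ω₁ / 2 - ω₁ = -(ω₁ / 2) := by ring
        have h6 := hshift (ω₁ / 2) h4 (by
          rw [h5]; exact fun h => h4 (by simpa using L.lattice.neg_mem h))
        rw [h5, L.weierstrassP_neg, hs] at h6
        rw [← h6]; ring
      refine heven (ω₁ / 2) hmem (by rwa [p0]) (w - ω₁ / 2) hp hq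
        (simple_zero _ _ _ (hAn _ _ hp hq) ?_ (hDer _ _ hp hq) ?_)
      · simp only [p0, p1, p2, hPw, hX, ← he, hE]
        rw [hee]; field_simp; linear_combination hx
      · simp only [p0, p1, p2, hPw, hX, ← he, hE]
        intro h0
        have h7 : 4 * (r : ℂ) ^ 2 * L.derivWeierstrassP w * (x ^ 2 - κ) = 0 := by
          have h8 : L.derivWeierstrassP (w - ω₁) = - L.derivWeierstrassP w * (κ / x) / x := by
            field_simp
            field_simp at hder
            linear_combination hder
          rw [h8, hee] at h0
          field_simp at h0
          linear_combination h0
        have h9 : x ^ 2 = κ := by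
          have := (mul_eq_zero.1 h7).resolve_left (by simp [hr0, hdw])
          linear_combination this
        have h10 : (m : ℂ) ^ 2 + 4 * r * (x + r) ^ 2 = 0 := by
          apply mul_left_cancel₀ hx0
          rw [← h9] at hx
          linear_combination hx
        have hreal : ∃ t : ℝ, x = t := by
          have h11 : (x - (s - e)) * (x + (s - e)) = 0 := by linear_combination h9 - hs2
          rcases mul_eq_zero.1 h11 with h | h
          · refine ⟨s - (r - a), ?_⟩
            push_cast; rw [← hee]; linear_combination h
          · refine ⟨-(s - (r - a)), ?_⟩
            push_cast; rw [← hee]; linear_combination h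
        obtain ⟨t, rfl⟩ := hreal
        have h12 : m ^ 2 + 4 * r * (t + r) ^ 2 = 0 := by exact_mod_cast h10
        have : 0 < m ^ 2 := by positivity
        have : 0 ≤ 4 * r * (t + r) ^ 2 := by positivity
        linarith

/-- analytic core of Theorem 3.6: if all zeros of
`z ↦ m² + 4(℘(2z₁)+a)(℘(z+z₁)+a)(℘(z−z₁)+a)` have even order for every `z₁` near `ℓ/4`,
then `m² = −4(℘(ℓ/2)+a)(℘(πi)+a)(℘(ℓ/2+πi)+a)`. -/
theorem stmt14 (ℓ a m : ℝ) (hℓ : 0 < ℓ)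
    (hpos : ∃ r : ℝ, 0 < r ∧
      wp (ℓ : ℂ) (2 * Real.pi * Complex.I) ((ℓ : ℂ) / 2) + (a : ℂ) = (r : ℂ))
    (heven : ∃ U : Set ℂ, IsOpen U ∧ ((ℓ : ℂ) / 4) ∈ U ∧
      ∀ z₁ ∈ U, 2 * z₁ ∉ lat (ℓ : ℂ) (2 * Real.pi * Complex.I) →
        ∀ z₀ : ℂ, z₀ + z₁ ∉ lat (ℓ : ℂ) (2 * Real.pi * Complex.I) →
          z₀ - z₁ ∉ lat (ℓ : ℂ) (2 * Real.pi * Complex.I) →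
          ∀ k : ℕ, Odd k →
            ¬∃ h : ℂ → ℂ, AnalyticAt ℂ h z₀ ∧ h z₀ ≠ 0 ∧
              (∀ᶠ z in nhds z₀,
                (m : ℂ) ^ 2 + 4 * (wp (ℓ : ℂ) (2 * Real.pi * Complex.I) (2 * z₁) + (a : ℂ))
                  * (wp (ℓ : ℂ) (2 * Real.pi * Complex.I) (z + z₁) + (a : ℂ))
                  * (wp (ℓ : ℂ) (2 * Real.pi * Complex.I) (z - z₁) + (a : ℂ))
                = (z - z₀) ^ k * h z)) :
    (m : ℂ) ^ 2 =
      -4 * (wp (ℓ : ℂ) (2 * Real.pi * Complex.I) ((ℓ : ℂ) / 2) + (a : ℂ))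
        * (wp (ℓ : ℂ) (2 * Real.pi * Complex.I) (Real.pi * Complex.I) + (a : ℂ))
        * (wp (ℓ : ℂ) (2 * Real.pi * Complex.I) ((ℓ : ℂ) / 2 + Real.pi * Complex.I) + (a : ℂ)) := by

  obtain ⟨r, hr, hE⟩ := hpos
  obtain ⟨U, hU, hmem, heven⟩ := heven
  obtain ⟨s, hs⟩ := wp_real ℓ (ℓ / 4)
  set L := ellPair ℓ hℓ with hL
  have hwp : ∀ z, wp (ℓ : ℂ) (2 * Real.pi * Complex.I) z = L.weierstrassP z :=
    fun z => wp_eq_wP L z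
  simp only [hwp, lat_eq ℓ hℓ] at *
  have hω₂ : L.ω₂ / 2 = Real.pi * Complex.I := by
    simp only [hL, ellPair]; ring
  have hω₁ : L.ω₁ / 2 = (ℓ : ℂ) / 2 := rfl
  have hq : (ℓ : ℂ) / 2 / 2 = (ℓ : ℂ) / 4 := by ring
  refine core L ((ℓ : ℂ) / 2) (Real.pi * Complex.I) a m r s ?_ ?_ ?_ ?_ ?_ ?_ hr hE ?_ U hU
    (by rwa [hq]) (fun z₁ h1 h2 z₀ h3 h4 => heven z₁ h1 h2 z₀ h3 h4 1 odd_one)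
  · rw [← hω₁]; exact L.ω₁_div_two_notMem_lattice
  · rw [← hω₂]; exact L.ω₂_div_two_notMem_lattice
  · have := (L.mul_ω₁_add_mul_ω₂_mem_lattice (α := -1 / 2) (β := 1 / 2)).not.mpr (by norm_num)
    rw [← hω₁, ← hω₂]
    convert this using 2
    push_cast; ring
  · rw [← hω₁, mul_div_cancel₀ _ two_ne_zero]; exact L.ω₁_mem_lattice
  · rw [← hω₂, mul_div_cancel₀ _ two_ne_zero]; exact L.ω₂_mem_lattice
  · have := (L.mul_ω₁_add_mul_ω₂_mem_lattice (α := 1 / 4) (β := 0)).not.mpr (by norm_num)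
    rw [← hω₁]
    convert this using 2
    push_cast; ring
  · rw [hq, ← hs]; push_cast; rfl
end

section
/- Let ℓ > 0 and set e₁ := ℘(ℓ/2; Λ_ℓ), e₂ := ℘(πi; Λ_ℓ), e₃ := ℘(ℓ/2 + πi; Λ_ℓ) (these are real). Let X, Y ∈ ℝ satisfy Y² = 4·(X − e₁)·(X − e₂)·(X − e₃) and X < e₁. Then there exists x ∈ ℝ such that X = ℘(x + πi; Λ_ℓ) and Y = ℘′(x + πi; Λ_ℓ). -/
open Complex

section Helpers

open Filter Topology

lemma cmpl_conn {s : Set ℂ} (hs : s.Countable) : IsPreconnected sᶜ := by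
  refine (hs.isConnected_compl_of_one_lt_rank ?_).isPreconnected
  simp [Complex.rank_real_complex]

lemma lat_countable (L : PeriodPair) : (L.lattice : Set ℂ).Countable := by
  have : Countable L.lattice := L.latticeEquivProd.toEquiv.countable_iff.mpr inferInstance
  exact Set.to_countable _

lemma wp_not_analytic_ext (L : PeriodPair) (g : ℂ → ℂ) (hg : AnalyticAt ℂ g 0)
    (h : ∀ᶠ z in 𝓝[≠] (0 : ℂ), L.weierstrassP z = g z) : False := by
  have h1 := L.order_weierstrassP 0 (zero_mem _)
  rw [meromorphicOrderAt_congr h] at h1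
  have h2 := hg.meromorphicOrderAt_nonneg
  rw [h1] at h2
  exact absurd h2 (by decide)

lemma ev_notMem (L : PeriodPair) : ∀ᶠ z in 𝓝[≠] (0 : ℂ), z ∉ L.lattice := by
  filter_upwards [self_mem_nhdsWithin, mem_nhdsWithin_of_mem_nhds
    (L.compl_lattice_sdiff_singleton_mem_nhds 0)] with w hw hw' hm
  exact hw' ⟨hm, hw⟩

lemma isOpen_D (L : PeriodPair) : IsOpen (L.lattice : Set ℂ)ᶜ := L.isClosed_lattice.isOpen_compl

lemma hasDerivAt_wp (L : PeriodPair) {z : ℂ} (hz : z ∉ L.lattice) :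
    HasDerivAt L.weierstrassP (L.derivWeierstrassP z) z := by
  rw [← L.deriv_weierstrassP]
  exact (L.analyticOnNhd_weierstrassP z hz).differentiableAt.hasDerivAt

lemma deriv_not_zero (L : PeriodPair) :
    ¬ ∀ z ∈ (L.lattice : Set ℂ)ᶜ, L.derivWeierstrassP z = 0 := by
  intro h
  obtain ⟨c, hc⟩ := (isOpen_D L).exists_is_const_of_deriv_eq_zero (cmpl_conn (lat_countable L))
    L.differentiableOn_weierstrassP (fun z hz => by rw [L.deriv_weierstrassP]; exact h z hz)
  refine wp_not_analytic_ext L (fun _ => c) analyticAt_const ?_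
  filter_upwards [ev_notMem L] with z hz using hc z hz

lemma second_deriv (L : PeriodPair) : ∀ z ∈ (L.lattice : Set ℂ)ᶜ,
    deriv L.derivWeierstrassP z = 6 * L.weierstrassP z ^ 2 - L.g₂ / 2 := by
  have hA := L.analyticOnNhd_weierstrassP
  have hA' := L.analyticOnNhd_derivWeierstrassP
  have key : ∀ z ∈ (L.lattice : Set ℂ)ᶜ, L.derivWeierstrassP z *
      (deriv L.derivWeierstrassP z - (6 * L.weierstrassP z ^ 2 - L.g₂ / 2)) = 0 := by
    intro z hz
    have e : (fun z => L.derivWeierstrassP z ^ 2) =ᶠ[𝓝 z]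
        fun z => 4 * L.weierstrassP z ^ 3 - L.g₂ * L.weierstrassP z - L.g₃ := by
      filter_upwards [(isOpen_D L).mem_nhds hz] with w hw using L.derivWeierstrassP_sq w hw
    have d1 := (hA' z hz).differentiableAt.hasDerivAt.pow 2
    have d0 := hasDerivAt_wp L hz
    have d2 := (((d0.pow 3).const_mul 4).sub (d0.const_mul L.g₂)).sub_const L.g₃
    have := d1.unique (d2.congr_of_eventuallyEq e)
    push_cast at this
    linear_combination this / 2
  rcases AnalyticOnNhd.eq_zero_or_eq_zero_of_mul_eq_zero hA' (g := fun z =>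
      (deriv L.derivWeierstrassP z - (6 * L.weierstrassP z ^ 2 - L.g₂ / 2)))
      (fun z hz => (hA' z hz).deriv.sub ((analyticAt_const.mul ((hA z hz).pow 2)).sub
        analyticAt_const)) key (cmpl_conn (lat_countable L)) with h | h
  · exact absurd h (deriv_not_zero L)
  · intro z hz
    exact sub_eq_zero.mp (h z hz)

lemma ode_unique {d h : ℂ → ℂ} {z : ℂ} (hd : AnalyticAt ℂ d z) (hh : AnalyticAt ℂ h z)
    (h0 : d z = 0) (h1 : deriv d z = 0) (h2 : ∀ᶠ w in 𝓝 z, deriv (deriv d) w = h w * d w) :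
    ∀ᶠ w in 𝓝 z, d w = 0 := by
  rw [← analyticOrderAt_eq_top]
  by_contra hne
  obtain ⟨n, hn⟩ := ENat.ne_top_iff_exists.mp hne
  have e1 := hd.analyticOrderAt_deriv_add_one
  have e2 := hd.deriv.analyticOrderAt_deriv_add_one
  simp only [h0, h1, sub_zero] at e1 e2
  have e3 : analyticOrderAt (deriv (deriv d)) z = analyticOrderAt h z + analyticOrderAt d z := by
    rw [← analyticOrderAt_mul hh hd]
    exact analyticOrderAt_congr h2
  rw [← e2, e3, ← hn] at e1
  have : ((n + 1 + 1 : ℕ) : ℕ∞) ≤ n := by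
    conv_rhs => rw [← e1]
    push_cast
    gcongr
    exact le_add_self
  have := ENat.natCast_le_natCast.mp this
  omega

lemma deriv_half (L : PeriodPair) {z : ℂ} (hz : 2 * z ∈ L.lattice) :
    L.derivWeierstrassP z = 0 := by
  have h1 := L.derivWeierstrassP_add_coe (-z) ⟨2 * z, hz⟩
  rw [L.derivWeierstrassP_neg] at h1
  have : -z + (2 * z) = z := by ring
  simp only [this] at h1
  linear_combination h1 / 2

lemma half_distinct (L : PeriodPair) {z₁ z₂ : ℂ} (h1 : z₁ ∉ L.lattice) (h2 : z₂ ∉ L.lattice)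
    (h1' : 2 * z₁ ∈ L.lattice) (h2' : 2 * z₂ ∈ L.lattice) (hc : z₂ - z₁ ∉ L.lattice) :
    L.weierstrassP z₁ ≠ L.weierstrassP z₂ := by
  intro heq
  set c := z₂ - z₁ with hcdef
  have hz2 : z₁ + c = z₂ := by rw [hcdef]; ring
  let S : Set ℂ := (L.lattice : Set ℂ) ∪ (fun z => z + c) ⁻¹' (L.lattice : Set ℂ)
  have hS : S.Countable :=
    (lat_countable L).union ((lat_countable L).preimage (add_left_injective c))
  have hSo : IsOpen Sᶜ := by
    have : IsClosed S := L.isClosed_lattice.union (L.isClosed_lattice.preimage (by fun_prop))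
    exact this.isOpen_compl
  have hmem : ∀ z, z ∈ Sᶜ ↔ z ∉ L.lattice ∧ z + c ∉ L.lattice := by
    intro z; simp [S]
  have hA := L.analyticOnNhd_weierstrassP
  have aG : ∀ z, z + c ∉ L.lattice → AnalyticAt ℂ (fun z => L.weierstrassP (z + c)) z := by
    intro z hz
    exact AnalyticAt.fun_comp (g := L.weierstrassP) (hA _ hz) (by fun_prop)
  have hz1 : z₁ ∈ Sᶜ := by rw [hmem]; exact ⟨h1, by rw [hz2]; exact h2⟩
  have ev : (fun z => L.weierstrassP z) =ᶠ[𝓝 z₁] fun z => L.weierstrassP (z + c) := by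
    have dd : ∀ z ∈ Sᶜ, deriv (fun z => L.weierstrassP z - L.weierstrassP (z + c)) z =
        L.derivWeierstrassP z - L.derivWeierstrassP (z + c) := by
      intro z hz
      rw [hmem] at hz
      exact ((hasDerivAt_wp L hz.1).sub ((hasDerivAt_wp L hz.2).comp_add_const z c)).deriv
    have := ode_unique (d := fun z => L.weierstrassP z - L.weierstrassP (z + c))
      (h := fun z => 6 * (L.weierstrassP z + L.weierstrassP (z + c))) (z := z₁)
      ((hA _ h1).sub (aG _ (by rw [hz2]; exact h2)))
      (analyticAt_const.mul ((hA _ h1).add (aG _ (by rw [hz2]; exact h2))))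
      (by simp only [hz2, heq, sub_self])
      (by rw [dd _ hz1, hz2, deriv_half L h1', deriv_half L h2', sub_self])
      (by
        filter_upwards [hSo.mem_nhds hz1] with w hw
        have : deriv (fun z => L.weierstrassP z - L.weierstrassP (z + c)) =ᶠ[𝓝 w]
            fun z => L.derivWeierstrassP z - L.derivWeierstrassP (z + c) := by
          filter_upwards [hSo.mem_nhds hw] with v hv using dd v hv
        rw [this.deriv_eq]
        rw [hmem] at hw
        have a1 := (L.analyticOnNhd_derivWeierstrassP w hw.1).differentiableAt.hasDerivAt
        have a2 := (L.analyticOnNhd_derivWeierstrassP _ hw.2).differentiableAt.hasDerivAt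
        refine ((a1.sub (a2.comp_add_const w c)).deriv).trans ?_
        rw [second_deriv L _ hw.1, second_deriv L _ hw.2]
        ring)
    filter_upwards [this] with w hw using sub_eq_zero.mp hw
  have eqon := AnalyticOnNhd.eqOn_of_preconnected_of_eventuallyEq (𝕜 := ℂ) (U := Sᶜ)
    (fun z hz => hA z ((hmem z).mp hz).1) (fun z hz => aG z ((hmem z).mp hz).2)
    (cmpl_conn hS) hz1 ev
  refine wp_not_analytic_ext L _ (aG 0 (by simpa using hc)) ?_
  have e2 : ∀ᶠ z in 𝓝[≠] (0 : ℂ), z + c ∉ L.lattice := by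
    have : IsOpen ((fun z => z + c) ⁻¹' (L.lattice : Set ℂ))ᶜ :=
      (L.isClosed_lattice.preimage (by fun_prop)).isOpen_compl
    exact mem_nhdsWithin_of_mem_nhds (this.mem_nhds (by simpa using hc))
  filter_upwards [ev_notMem L, e2] with z hz hz'
  exact eqon ((hmem z).mpr ⟨hz, hz'⟩)

lemma wp_eq_s15 (L : PeriodPair) : wp L.ω₁ L.ω₂ = L.weierstrassP := by
  funext z
  have hs := L.latticeEquivProd.symm.toEquiv.hasSum_iff.mpr (L.hasSum_weierstrassP z)
  have hs' : HasSum (fun p : ℤ × ℤ => 1 / (z - ((p.1 : ℂ) * L.ω₁ + (p.2 : ℂ) * L.ω₂)) ^ 2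
      - 1 / ((p.1 : ℂ) * L.ω₁ + (p.2 : ℂ) * L.ω₂) ^ 2) (L.weierstrassP z) := by
    convert hs using 2 with p
    have := L.latticeEquiv_symm_apply p
    simp [← this]
  have := hs'.summable.sum_add_tsum_compl (s := {0})
  rw [← hs'.tsum_eq, ← this, wp]
  simp only [Finset.sum_singleton]
  congr 1
  · simp
  · exact (Equiv.subtypeEquivRight (p := fun p : ℤ × ℤ => p ≠ 0)
      (q := fun p => p ∈ ((({0} : Finset (ℤ × ℤ)) : Set (ℤ × ℤ))ᶜ)) (by simp)).tsum_eq
      (fun p => 1 / (z - ((p.1.1 : ℂ) * L.ω₁ + (p.1.2 : ℂ) * L.ω₂)) ^ 2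
      - 1 / ((p.1.1 : ℂ) * L.ω₁ + (p.1.2 : ℂ) * L.ω₂) ^ 2)

lemma wp_conj (ℓ : ℝ) (z : ℂ) :
    (starRingEnd ℂ) (wp (ℓ : ℂ) (2 * Real.pi * Complex.I) z)
      = wp (ℓ : ℂ) (2 * Real.pi * Complex.I) ((starRingEnd ℂ) z) := by
  unfold wp
  rw [map_add, Complex.conj_tsum]
  congr 1
  · simp
  let e : {p : ℤ × ℤ // p ≠ 0} ≃ {p : ℤ × ℤ // p ≠ 0} :=
    Equiv.subtypeEquiv (Equiv.prodCongr (Equiv.refl ℤ) (Equiv.neg ℤ)) (by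
      rintro ⟨a, b⟩; simp [Prod.ext_iff])
  rw [← e.tsum_eq]
  congr 1
  funext p
  simp [e, map_ofNat (starRingEnd ℂ) 2]

end Helpers

/-- Corollary after Theorem 3.6: the bounded real component of the elliptic
curve `Y² = 4(X−e₁)(X−e₂)(X−e₃)` is parameterized by the circle `{Im z = π}`. -/
theorem stmt15 (ℓ : ℝ) (hℓ : 0 < ℓ) (X Y : ℝ)
    (hcurve : Y ^ 2 =
      4 * (X - (wp (ℓ : ℂ) (2 * Real.pi * Complex.I) ((ℓ : ℂ) / 2)).re)
        * (X - (wp (ℓ : ℂ) (2 * Real.pi * Complex.I) (Real.pi * Complex.I)).re)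
        * (X - (wp (ℓ : ℂ) (2 * Real.pi * Complex.I) ((ℓ : ℂ) / 2 + Real.pi * Complex.I)).re))
    (hlt : X < (wp (ℓ : ℂ) (2 * Real.pi * Complex.I) ((ℓ : ℂ) / 2)).re) :
    ∃ x : ℝ,
      (X : ℂ) = wp (ℓ : ℂ) (2 * Real.pi * Complex.I) ((x : ℂ) + Real.pi * Complex.I) ∧
      (Y : ℂ) = deriv (wp (ℓ : ℂ) (2 * Real.pi * Complex.I))
        ((x : ℂ) + Real.pi * Complex.I) := by
  have hpi := Real.pi_pos
  let L : PeriodPair := ⟨(ℓ : ℂ), 2 * Real.pi * Complex.I, by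
    rw [LinearIndependent.pair_iff]
    intro s t h
    have h1 := congrArg Complex.re h
    have h2 := congrArg Complex.im h
    simp at h1 h2
    exact ⟨h1.resolve_right hℓ.ne', h2⟩⟩
  have hwp : wp (ℓ : ℂ) (2 * Real.pi * Complex.I) = L.weierstrassP := wp_eq_s15 L
  have hconj := wp_conj ℓ
  rw [hwp] at hcurve hlt hconj ⊢
  rw [L.deriv_weierstrassP]
  have m1 : (ℓ : ℂ) ∈ L.lattice := L.ω₁_mem_lattice
  have m2 : (2 * Real.pi * Complex.I : ℂ) ∈ L.lattice := L.ω₂_mem_lattice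
  have im_lat : ∀ z ∈ L.lattice, ∃ m n : ℤ, z.re = m * ℓ ∧ z.im = n * (2 * Real.pi) := by
    intro z hz
    obtain ⟨m, n, rfl⟩ := PeriodPair.mem_lattice.mp hz
    exact ⟨m, n, by simp [L], by simp [L]⟩
  have half_int : ∀ n : ℤ, ∀ a : ℝ, a ≠ 0 → a ≠ n * (2 * a) := by
    intro n a ha h
    have : (1 : ℝ) = n * 2 := by
      apply mul_left_cancel₀ ha; linear_combination h
    have : (1 : ℤ) = n * 2 := by exact_mod_cast this
    omega
  have notim : ∀ z : ℂ, z.im = Real.pi → z ∉ L.lattice := by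
    intro z hz hm
    obtain ⟨m, n, -, h⟩ := im_lat z hm
    exact half_int n _ hpi.ne' (hz ▸ h)
  have notre : ∀ z : ℂ, z.re = ℓ / 2 → z ∉ L.lattice := by
    intro z hz hm
    obtain ⟨m, n, h, -⟩ := im_lat z hm
    exact half_int m (ℓ / 2) (by positivity) (by linear_combination h - hz)
  -- symmetry and reality
  have symP : ∀ x : ℝ, L.weierstrassP ((-x : ℝ) + Real.pi * Complex.I)
      = L.weierstrassP (x + Real.pi * Complex.I) := by
    intro x
    have := L.weierstrassP_add_coe (-(x + Real.pi * Complex.I)) ⟨_, m2⟩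
    rw [L.weierstrassP_neg] at this
    rw [← this]; congr 1; push_cast; ring
  have symD : ∀ x : ℝ, L.derivWeierstrassP ((-x : ℝ) + Real.pi * Complex.I)
      = - L.derivWeierstrassP (x + Real.pi * Complex.I) := by
    intro x
    have := L.derivWeierstrassP_add_coe (-(x + Real.pi * Complex.I)) ⟨_, m2⟩
    rw [L.derivWeierstrassP_neg] at this
    rw [← this]; congr 1; push_cast; ring
  have real1 : ∀ x : ℝ, ((L.weierstrassP (x + Real.pi * Complex.I)).re : ℂ)
      = L.weierstrassP (x + Real.pi * Complex.I) := by
    intro x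
    apply Complex.conj_eq_iff_re.mp
    rw [hconj, ← symP, ← L.weierstrassP_neg]
    congr 1; simp [add_comm]
  have real2 : ((L.weierstrassP (ℓ / 2)).re : ℂ) = L.weierstrassP (ℓ / 2) := by
    apply Complex.conj_eq_iff_re.mp
    rw [hconj]
    congr 1; simp [map_ofNat (starRingEnd ℂ) 2]
  have r2 := real1 0
  have r3 := real1 (ℓ / 2)
  push_cast at r2 r3
  rw [zero_add] at r2
  set E1 := (L.weierstrassP (ℓ / 2)).re
  set E2 := (L.weierstrassP (Real.pi * Complex.I)).re
  set E3 := (L.weierstrassP (ℓ / 2 + Real.pi * Complex.I)).re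
  have n1 : (ℓ / 2 : ℂ) ∉ L.lattice := notre _ (by simp)
  have n2 : (Real.pi * Complex.I : ℂ) ∉ L.lattice := notim _ (by simp)
  have n3 : (ℓ / 2 + Real.pi * Complex.I : ℂ) ∉ L.lattice := notim _ (by simp)
  have d1 : 2 * (ℓ / 2 : ℂ) ∈ L.lattice := by
    rw [show 2 * (ℓ / 2 : ℂ) = ℓ by ring]; exact m1
  have d2 : 2 * (Real.pi * Complex.I : ℂ) ∈ L.lattice := by
    rw [← mul_assoc]; exact m2
  have d3 : 2 * (ℓ / 2 + Real.pi * Complex.I : ℂ) ∈ L.lattice := by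
    rw [mul_add]; exact add_mem d1 d2
  have ne13 := half_distinct L n1 n3 d1 d3 (by rw [add_sub_cancel_left]; exact n2)
  have ne12 := half_distinct L n1 n2 d1 d2 (notim _ (by simp))
  have ne23 := half_distinct L n2 n3 d2 d3 (by rw [add_sub_cancel_right]; exact n1)
  have q1 := L.derivWeierstrassP_sq _ n1
  have q2 := L.derivWeierstrassP_sq _ n2
  have q3 := L.derivWeierstrassP_sq _ n3
  rw [deriv_half L d1] at q1
  rw [deriv_half L d2] at q2
  rw [deriv_half L d3] at q3
  have fact : ∀ z ∉ L.lattice, L.derivWeierstrassP z ^ 2 =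
      4 * (L.weierstrassP z - E1) * (L.weierstrassP z - E2) * (L.weierstrassP z - E3) := by
    intro z hz
    rw [L.derivWeierstrassP_sq z hz, real2, r2, r3]
    generalize L.weierstrassP (ℓ / 2) = a at *
    generalize L.weierstrassP (Real.pi * Complex.I) = b at *
    generalize L.weierstrassP (ℓ / 2 + Real.pi * Complex.I) = c at *
    generalize L.weierstrassP z = t
    have s1 : L.g₂ = 4 * (a ^ 2 + a * b + b ^ 2) := by
      apply mul_left_cancel₀ (sub_ne_zero.mpr ne12); linear_combination q1 - q2
    have s2 : L.g₂ = 4 * (a ^ 2 + a * c + c ^ 2) := by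
      apply mul_left_cancel₀ (sub_ne_zero.mpr ne13); linear_combination q1 - q3
    have s3 : a + b + c = 0 := by
      apply mul_left_cancel₀ (sub_ne_zero.mpr ne23); linear_combination (s2 - s1) / 4
    have s4 : c = - a - b := by linear_combination s3
    have s5 : L.g₃ = 4 * a ^ 3 - L.g₂ * a := by linear_combination q1
    rw [s5, s1, s4]; ring
  -- X lies between E2 and E3
  have hX : X ∈ Set.uIcc E2 E3 := by
    have hp : (X - E2) * (X - E3) ≤ 0 := by
      by_contra hcon
      push Not at hcon
      nlinarith [sq_nonneg Y, mul_pos (sub_pos.mpr hlt) hcon]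
    rw [Set.mem_uIcc]
    rcases mul_nonpos_iff.mp hp with h | h
    · left; constructor <;> linarith [h.1, h.2]
    · right; constructor <;> linarith [h.1, h.2]
  have hcont : Continuous fun x : ℝ => (L.weierstrassP (x + Real.pi * Complex.I)).re := by
    refine Complex.continuous_re.comp (continuous_iff_continuousAt.mpr fun x => ?_)
    have hc := (L.analyticOnNhd_weierstrassP (x + Real.pi * Complex.I)
      (notim _ (by simp))).continuousAt
    exact ContinuousAt.comp (f := fun x : ℝ => (x + Real.pi * Complex.I : ℂ)) hc
      (by fun_prop)
  have ivt := intermediate_value_uIcc (a := (0 : ℝ)) (b := ℓ / 2) hcont.continuousOn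
  obtain ⟨x, -, hx⟩ := ivt (a := X) (by simpa [E2, E3] using hX)
  have hx' : (X : ℂ) = L.weierstrassP (x + Real.pi * Complex.I) := by
    rw [← real1, ← hx]
  have hsq := fact (x + Real.pi * Complex.I) (notim _ (by simp))
  rw [← hx'] at hsq
  have hY : (Y : ℂ) ^ 2 = L.derivWeierstrassP (x + Real.pi * Complex.I) ^ 2 := by
    rw [hsq]; exact_mod_cast hcurve
  rcases sq_eq_sq_iff_eq_or_eq_neg.mp hY with h | h
  · exact ⟨x, hx', h⟩
  · exact ⟨-x, by rw [symP]; exact hx', by rw [symD]; exact h⟩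
end
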